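/- arXiv:2106.15949 — 2 statements merged into one kernel-verified Lean document; each statement's English description precedes it below -/
import Mathlib

section
/- Assume the Riemann Hypothesis. Let q : [1, ∞) → ℂ be a function with q(x) = o(1) as x → +∞ (and locally integrable). Then there exists a completely multiplicative function χ : ℕ → ℂ with |χ(n)| = 1 for all n ≥ 1 such that the function s ↦ ∫₁^∞ q(x) x^{-s} dx + Σ_p χ(p) p^{-s} log p (the sum over all primes p), initially defined and analytic in the half-plane Re s > 1, extends analytically to the half-plane Re s > 1/2. -/
open Complex Filter Topology Set MeasureTheory

theorem holo_integral {α : Type*} [MeasurableSpace α] {μ : Measure α} {U : Set ℂ} (hU : IsOpen U)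
    (F : ℂ → α → ℂ) (b : α → ℝ) (hb : Integrable b μ)
    (hm : ∀ z ∈ U, AEStronglyMeasurable (F z) μ)
    (hd : ∀ᵐ a ∂μ, DifferentiableOn ℂ (fun z => F z a) U)
    (hbd : ∀ᵐ a ∂μ, ∀ z ∈ U, ‖F z a‖ ≤ b a) :
    DifferentiableOn ℂ (fun z => ∫ a, F z a ∂μ) U := by
  intro z hz
  obtain ⟨r, hr, hrU⟩ := Metric.isOpen_iff.mp hU z hz
  have hm' : AEStronglyMeasurable (fun a => deriv (fun w => F w a) z) μ := by
    have h0 : ∃ N : ℕ, ∀ n : ℕ, N ≤ n → z + (1 / ((n : ℂ) + 1)) ∈ U := by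
      have : Tendsto (fun n : ℕ => z + (1 / ((n : ℂ) + 1))) atTop (𝓝 (z + 0)) :=
        tendsto_const_nhds.add tendsto_one_div_add_atTop_nhds_zero_nat
      rw [add_zero] at this
      exact eventually_atTop.mp (this.eventually (hU.mem_nhds hz))
    obtain ⟨N, hN⟩ := h0
    refine aestronglyMeasurable_of_tendsto_ae atTop
      (f := fun (n : ℕ) a => (1 / (((n + N : ℕ) : ℂ) + 1))⁻¹ • (F (z + (1 / (((n + N : ℕ) : ℂ) + 1))) a - F z a)) ?_ ?_
    · intro n
      have h := (hm _ (hN (n + N) (by omega))).sub (hm z hz)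
      exact h.const_smul (1 / (((n + N : ℕ) : ℂ) + 1))⁻¹
    · filter_upwards [hd] with a ha
      have h1 := ((ha z hz).differentiableAt (hU.mem_nhds hz)).hasDerivAt
      rw [hasDerivAt_iff_tendsto_slope_zero] at h1
      refine h1.comp ?_
      refine tendsto_nhdsWithin_iff.mpr ⟨?_, ?_⟩
      · exact (tendsto_add_atTop_iff_nat (f := fun n : ℕ => (1 / ((n : ℂ) + 1))) N).mpr
          tendsto_one_div_add_atTop_nhds_zero_nat
      · refine Eventually.of_forall fun n => ?_
        simp only [mem_compl_iff, mem_singleton_iff]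
        have : (((n + N : ℕ) : ℂ) + 1) ≠ 0 := Nat.cast_add_one_ne_zero _
        exact one_div_ne_zero this
  have := hasDerivAt_integral_of_dominated_loc_of_deriv_le (μ := μ) (F := F) (x₀ := z)
    (F' := fun w a => deriv (fun w => F w a) w) (bound := fun a => b a / (r / 2))
    (s := Metric.ball z (r / 2)) (Metric.ball_mem_nhds _ (by positivity)) ?_ ?_ hm' ?_ (hb.div_const _) ?_
  · exact this.2.differentiableAt.differentiableWithinAt
  · filter_upwards [hU.mem_nhds hz] with w hw using hm w hw
  · refine hb.mono' (hm z hz) ?_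
    filter_upwards [hbd] with a ha using ha z hz
  · filter_upwards [hd, hbd] with a ha hba w hw
    have hsub : Metric.closedBall w (r / 2) ⊆ U := by
      intro y hy
      apply hrU
      rw [Metric.mem_ball] at *
      rw [Metric.mem_closedBall] at hy
      linarith [dist_triangle y w z]
    apply Complex.norm_deriv_le_of_forall_mem_sphere_norm_le (by positivity)
    · exact (ha.mono (by
        rw [closure_ball _ (by positivity)]; exact hsub)).diffContOnCl
    · intro y hy
      exact hba y (hsub (Metric.sphere_subset_closedBall hy))
  · filter_upwards [hd] with a ha w hw
    have : w ∈ U := hrU (Metric.ball_subset_ball (by linarith) hw)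
    exact ((ha w this).differentiableAt (hU.mem_nhds this)).hasDerivAt

theorem mellin_diff {σ₀ : ℝ} (f : ℝ → ℂ) (hf : AEStronglyMeasurable f (volume.restrict (Ioi 1)))
    (h : ∀ σ > σ₀, IntegrableOn (fun x => ‖f x‖ * x ^ (-(σ + 1))) (Ioi 1)) :
    DifferentiableOn ℂ (fun s => ∫ x in Ioi (1 : ℝ), f x * (x : ℂ) ^ (-(s + 1))) {s : ℂ | σ₀ < s.re} := by
  intro s hs
  have hs' : σ₀ < s.re := hs
  obtain ⟨τ, h1, h2⟩ := exists_between hs'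
  have hU : IsOpen {s : ℂ | τ < s.re} := isOpen_lt continuous_const continuous_re
  have := holo_integral hU (μ := volume.restrict (Ioi (1 : ℝ))) (fun s x => f x * (x : ℂ) ^ (-(s + 1)))
    (fun x => ‖f x‖ * x ^ (-(τ + 1))) (h τ h1) ?_ ?_ ?_
  · exact ((this s h2).differentiableAt (hU.mem_nhds h2)).differentiableWithinAt
  · intro z hz
    refine hf.mul ?_
    apply ContinuousOn.aestronglyMeasurable _ measurableSet_Ioi
    intro x hx
    apply ContinuousAt.continuousWithinAt
    have hx : (1 : ℝ) < x := hx
    exact Complex.continuousAt_ofReal_cpow_const _ _ (Or.inr (by positivity))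
  · filter_upwards [ae_restrict_mem measurableSet_Ioi] with x hx
    have hx : (1 : ℝ) < x := hx
    have : (x : ℂ) ≠ 0 := by norm_cast; positivity
    intro z _
    apply DifferentiableAt.differentiableWithinAt
    apply DifferentiableAt.const_mul
    exact DifferentiableAt.const_cpow (by fun_prop) (Or.inl this)
  · filter_upwards [ae_restrict_mem measurableSet_Ioi] with x hx z hz
    have hx : (1 : ℝ) < x := hx
    have hz : τ < z.re := hz
    rw [norm_mul, Complex.norm_cpow_eq_rpow_re_of_pos (by positivity)]
    gcongr
    · exact hx.le
    · simp; linarith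

theorem zeta_repr {s : ℂ} (hs : 1 < s.re) :
    riemannZeta₁ s = s - s * (s - 1) * ∫ x in Ioi (1 : ℝ), ((Int.fract x : ℝ) : ℂ) * (x : ℂ) ^ (-(s + 1)) := by
  have hs1 : s ≠ 1 := by rintro rfl; simp at hs
  have hs1' : s - 1 ≠ 0 := sub_ne_zero.mpr hs1
  have hz := riemannZeta_eq_inv_sub_mul hs1
  have h1 : riemannZeta s = s * ∫ t in Ioi (1 : ℝ), (∑ k ∈ Finset.Icc 1 ⌊t⌋₊, (1 : ℕ → ℂ) k) * (t : ℂ) ^ (-(s + 1)) := by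
    rw [← LSeries_one_eq_riemannZeta hs]
    apply LSeries_eq_mul_integral' _ zero_le_one hs
    simp
    exact Asymptotics.isBigO_refl _ _
  have hI1 : IntegrableOn (fun x : ℝ => (x : ℂ) ^ (-s)) (Ioi 1) :=
    integrableOn_Ioi_cpow_of_lt (by simpa using hs) one_pos
  have hI1v : ∫ x in Ioi (1 : ℝ), (x : ℂ) ^ (-s) = 1 / (s - 1) := by
    rw [integral_Ioi_cpow_of_lt (by simpa using hs) one_pos]
    simp
    rw [show -s + 1 = -(s - 1) by ring]; field_simp
  have hI2 : IntegrableOn (fun x : ℝ => ((Int.fract x : ℝ) : ℂ) * (x : ℂ) ^ (-(s + 1))) (Ioi 1) := by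
    refine Integrable.mono' (g := fun x : ℝ => x ^ (-(s.re + 1))) ?_ ?_ ?_
    · exact integrableOn_Ioi_rpow_of_lt (by linarith) one_pos
    · refine AEStronglyMeasurable.mul ?_ ?_
      · exact (Complex.measurable_ofReal.comp measurable_fract).aestronglyMeasurable
      · apply ContinuousOn.aestronglyMeasurable _ measurableSet_Ioi
        intro x hx
        apply ContinuousAt.continuousWithinAt
        have hx : (1 : ℝ) < x := hx
        exact Complex.continuousAt_ofReal_cpow_const _ _ (Or.inr (by positivity))
    · filter_upwards [ae_restrict_mem measurableSet_Ioi] with x hx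
      have hx : (1 : ℝ) < x := hx
      rw [norm_mul, Complex.norm_cpow_eq_rpow_re_of_pos (by positivity)]
      have : ‖((Int.fract x : ℝ) : ℂ)‖ ≤ 1 := by
        rw [Complex.norm_real, Real.norm_eq_abs, abs_of_nonneg (Int.fract_nonneg _)]
        exact (Int.fract_lt_one _).le
      calc _ ≤ 1 * x ^ (-(s + 1)).re := by gcongr
        _ = _ := by simp
  have h2 : ∫ t in Ioi (1 : ℝ), (∑ k ∈ Finset.Icc 1 ⌊t⌋₊, (1 : ℕ → ℂ) k) * (t : ℂ) ^ (-(s + 1)) =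
      1 / (s - 1) - ∫ x in Ioi (1 : ℝ), ((Int.fract x : ℝ) : ℂ) * (x : ℂ) ^ (-(s + 1)) := by
    rw [← hI1v, ← integral_sub hI1 hI2]
    apply setIntegral_congr_fun measurableSet_Ioi
    intro x hx
    have hx : (1 : ℝ) < x := hx
    have hx0 : (x : ℂ) ≠ 0 := by norm_cast; positivity
    have : (x : ℂ) ^ (-s) = x * (x : ℂ) ^ (-(s + 1)) := by
      rw [show -s = 1 + (-(s + 1)) by ring, Complex.cpow_add _ _ hx0, Complex.cpow_one]
    simp only [this, Pi.one_apply, Finset.sum_const, Nat.card_Icc, add_tsub_cancel_right, nsmul_eq_mul, mul_one]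
    rw [← sub_mul]
    congr 1
    have h3 : ((⌊x⌋₊ : ℕ) : ℝ) = x - Int.fract x := by
      rw [natCast_floor_eq_intCast_floor (by positivity)]
      linarith [Int.floor_add_fract x]
    have h4 : ((⌊x⌋₊ : ℕ) : ℂ) = ((⌊x⌋₊ : ℕ) : ℝ) := by simp
    rw [h4, h3]; push_cast; ring
  rw [h1, h2] at hz
  field_simp at hz
  rw [← hz]; ring

theorem Z_bound {s : ℂ} (hs : 1 / 2 ≤ s.re) : ‖riemannZeta₁ s‖ ≤ ‖s‖ * (1 + 2 * ‖s - 1‖) := by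
  set R : ℂ → ℂ := fun s => ∫ x in Ioi (1 : ℝ), ((Int.fract x : ℝ) : ℂ) * (x : ℂ) ^ (-(s + 1)) with hR
  have hfn : ∀ x : ℝ, ‖((Int.fract x : ℝ) : ℂ)‖ ≤ 1 := by
    intro x
    rw [Complex.norm_real, Real.norm_eq_abs, abs_of_nonneg (Int.fract_nonneg _)]
    exact (Int.fract_lt_one _).le
  have hd : DifferentiableOn ℂ R {s : ℂ | 0 < s.re} := by
    apply mellin_diff
    · exact (Complex.measurable_ofReal.comp measurable_fract).aestronglyMeasurable
    · intro σ hσ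
      refine Integrable.mono' (g := fun x : ℝ => x ^ (-(σ + 1)))
        (integrableOn_Ioi_rpow_of_lt (by linarith) one_pos) ?_ ?_
      · exact ((Complex.measurable_ofReal.comp measurable_fract).norm.mul
          (by fun_prop)).aestronglyMeasurable
      · filter_upwards [ae_restrict_mem measurableSet_Ioi] with x hx
        have hx : (1 : ℝ) < x := hx
        rw [norm_mul, norm_norm, Real.norm_of_nonneg (r := x ^ _) (by positivity)]
        calc _ ≤ 1 * x ^ (-(σ + 1)) := by gcongr; exact hfn x
          _ = _ := one_mul _
  have hU : IsOpen {s : ℂ | 0 < s.re} := isOpen_lt continuous_const continuous_re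
  have heq : EqOn riemannZeta₁ (fun s => s - s * (s - 1) * R s) {s : ℂ | 0 < s.re} := by
    refine AnalyticOnNhd.eqOn_of_preconnected_of_eventuallyEq (z₀ := 2)
      (differentiable_riemannZeta₁.differentiableOn.analyticOnNhd hU) ?_ ?_ (by simp) ?_
    · apply DifferentiableOn.analyticOnNhd _ hU
      exact (differentiableOn_id).sub ((by fun_prop : DifferentiableOn ℂ (fun s : ℂ => s * (s - 1)) _).mul hd)
    · exact (convex_halfSpace_re_gt 0).isPreconnected
    · have : {s : ℂ | 1 < s.re} ∈ 𝓝 (2 : ℂ) :=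
        (isOpen_lt continuous_const continuous_re).mem_nhds (by simp)
      filter_upwards [this] with s hs using zeta_repr hs
  have hs0 : 0 < s.re := by linarith
  have hRb : ‖R s‖ ≤ 2 := by
    have h1 : ‖R s‖ ≤ ∫ x in Ioi (1 : ℝ), x ^ (-(s.re + 1)) := by
      apply norm_integral_le_of_norm_le (integrableOn_Ioi_rpow_of_lt (by linarith) one_pos)
      filter_upwards [ae_restrict_mem measurableSet_Ioi] with x hx
      have hx : (1 : ℝ) < x := hx
      rw [norm_mul, Complex.norm_cpow_eq_rpow_re_of_pos (by positivity)]
      calc _ ≤ 1 * x ^ (-(s + 1)).re := by gcongr; exact hfn x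
        _ = _ := by simp
    refine h1.trans ?_
    rw [integral_Ioi_rpow_of_lt (by linarith) one_pos]
    simp only [Real.one_rpow]
    rw [show -(s.re + 1) + 1 = - s.re by ring, neg_div_neg_eq, div_le_iff₀ hs0]
    linarith
  rw [heq hs0]
  calc ‖s - s * (s - 1) * R s‖ ≤ ‖s‖ + ‖s * (s - 1) * R s‖ := norm_sub_le _ _
    _ = ‖s‖ + ‖s‖ * ‖s - 1‖ * ‖R s‖ := by rw [norm_mul, norm_mul]
    _ ≤ ‖s‖ + ‖s‖ * ‖s - 1‖ * 2 := by gcongr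
    _ = _ := by ring

theorem Z_lower (t : ℝ) : 1 / 4 ≤ ‖riemannZeta₁ (2 + t * I)‖ := by
  set s : ℂ := 2 + t * I with hs
  have hre : s.re = 2 := by simp [hs]
  have hs1 : s ≠ 1 := by intro h; rw [h] at hre; norm_num at hre
  have h1 : riemannZeta₁ s = (s - 1) * riemannZeta s := by
    rw [riemannZeta_eq_inv_sub_mul hs1, mul_inv_cancel_left₀ (sub_ne_zero.mpr hs1)]
  have h2 : 1 ≤ ‖s - 1‖ := by
    refine le_trans ?_ (Complex.abs_re_le_norm _)
    simp [hre]; norm_num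
  have h3 : 1 / 4 ≤ ‖riemannZeta s‖ := by
    have e1 := zeta_eq_tsum_one_div_nat_add_one_cpow (s := s) (by rw [hre]; norm_num)
    have hsum : Summable (fun n : ℕ => 1 / ((n : ℂ) + 1) ^ s) := by
      have := (Complex.summable_one_div_nat_cpow (p := s)).mpr (by rw [hre]; norm_num)
      have := (summable_nat_add_iff 1).mpr this
      simpa using this
    have hn : ∀ n : ℕ, ‖1 / ((n : ℂ) + 1) ^ s‖ = 1 / ((n : ℝ) + 1) ^ 2 := by
      intro n
      rw [norm_div, norm_one]
      have : ((n : ℂ) + 1) = (((n : ℝ) + 1 : ℝ) : ℂ) := by push_cast; rfl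
      rw [this, Complex.norm_cpow_eq_rpow_re_of_pos (by positivity), hre]
      norm_num
    have hz2 := hasSum_zeta_two
    have hz2' : HasSum (fun n : ℕ => 1 / ((n : ℝ) + 1) ^ 2) (Real.pi ^ 2 / 6) := by
      have := (hasSum_nat_add_iff' 1).mpr hz2
      simpa using this
    have hz3 : HasSum (fun n : ℕ => 1 / (((n + 1 : ℕ) : ℝ) + 1) ^ 2) (Real.pi ^ 2 / 6 - 1) := by
      have := (hasSum_nat_add_iff' 1).mpr hz2'
      simpa using this
    rw [hsum.tsum_eq_zero_add] at e1
    have h4 : ‖∑' n : ℕ, 1 / (((n + 1 : ℕ) : ℂ) + 1) ^ s‖ ≤ Real.pi ^ 2 / 6 - 1 := by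
      apply tsum_of_norm_bounded hz3
      intro n
      rw [hn (n + 1)]
    have hpi := Real.pi_lt_d2
    have hpi0 := Real.pi_pos
    have h5 : Real.pi ^ 2 / 6 - 1 ≤ 3 / 4 := by nlinarith
    rw [e1]
    simp only [Nat.cast_zero, zero_add, Complex.one_cpow, div_one]
    have := norm_sub_le_norm_add (1 : ℂ) (∑' n : ℕ, 1 / (((n + 1 : ℕ) : ℂ) + 1) ^ s)
    rw [norm_one] at this
    linarith
  rw [h1, norm_mul]
  nlinarith [norm_nonneg (riemannZeta s)]

theorem Z_ne_zero (hRH : RiemannHypothesis) {s : ℂ} (hs : 1 / 2 < s.re) : riemannZeta₁ s ≠ 0 := by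
  rcases eq_or_ne s 1 with rfl | h1
  · simp
  · intro h
    have hz := riemannZeta_eq_inv_sub_mul h1
    rw [h, mul_zero] at hz
    have := hRH s hz ?_ h1
    · linarith
    · rintro ⟨n, rfl⟩
      simp at hs
      have : (0 : ℝ) ≤ n := Nat.cast_nonneg n
      norm_num at hs
      linarith

/-- Logarithmic derivative of `(s-1) ζ(s)`. -/
noncomputable def LD (s : ℂ) : ℂ := deriv riemannZeta₁ s / riemannZeta₁ s

theorem LD_diff (hRH : RiemannHypothesis) : DifferentiableOn ℂ LD {s : ℂ | 1 / 2 < s.re} := by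
  intro s hs
  apply DifferentiableAt.differentiableWithinAt
  exact (differentiable_riemannZeta₁.deriv s).div (differentiable_riemannZeta₁ s) (Z_ne_zero hRH hs)

theorem LD_bound (hRH : RiemannHypothesis) {δ : ℝ} (hδ : 0 < δ) (hδ' : δ < 1 / 2) :
    ∃ C : ℝ, 0 < C ∧ ∀ s : ℂ, |s.re - 2| ≤ 3 / 2 - 2 * δ → ‖LD s‖ ≤ C * (1 + |s.im|) ^ (1 / 4 : ℝ) := by
  refine ⟨(2 * 64 * (3 / 2) / δ) / δ, by positivity, ?_⟩
  intro s hs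
  set t := s.im with ht
  set c : ℂ := 2 + t * I with hc
  have hcre : c.re = 2 := by simp [hc]
  have hcim : c.im = t := by simp [hc]
  have hball : ∀ w ∈ Metric.ball c (3 / 2), 1 / 2 < w.re := by
    intro w hw
    rw [Metric.mem_ball, Complex.dist_eq] at hw
    have := (Complex.abs_re_le_norm (w - c)).trans_lt hw
    rw [Complex.sub_re, hcre, abs_lt] at this
    linarith [this.1]
  have hLDb : DifferentiableOn ℂ LD (Metric.ball c (3 / 2)) := (LD_diff hRH).mono hball
  obtain ⟨f, hfc, hf⟩ := hLDb.isExactOn_ball.with_val_at c 0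
  have hZc := Z_lower t
  have hZc0 : riemannZeta₁ c ≠ 0 := by
    intro h; rw [← hc, h] at hZc; norm_num at hZc
  have hexp : ∀ w ∈ Metric.ball c (3 / 2), riemannZeta₁ w = riemannZeta₁ c * exp (f w) := by
    have hcon : ∀ w ∈ Metric.ball c (3 / 2), riemannZeta₁ w * exp (- f w) = riemannZeta₁ c * exp (- f c) := by
      intro w hw
      have hD : ∀ w ∈ Metric.ball c (3 / 2), HasDerivAt (fun w => riemannZeta₁ w * exp (- f w)) 0 w := by
        intro w hw
        have h1 := (differentiable_riemannZeta₁ w).hasDerivAt.mul (hf w hw).neg.cexp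
        refine h1.congr_deriv ?_
        have := Z_ne_zero hRH (hball w hw)
        simp only [LD]
        field_simp
        ring
      refine (convex_ball c (3 / 2)).is_const_of_fderivWithin_eq_zero (𝕜 := ℂ) (f := fun w => riemannZeta₁ w * exp (- f w)) ?_ ?_ hw
        (Metric.mem_ball_self (by norm_num))
      · intro w hw; exact (hD w hw).differentiableAt.differentiableWithinAt
      · intro w hw
        rw [fderivWithin_of_isOpen Metric.isOpen_ball hw]
        ext
        simp [(hD w hw).deriv]
    intro w hw
    have h1 := hcon w hw
    rw [hfc, neg_zero, exp_zero, mul_one] at h1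
    rw [← h1, mul_assoc, ← exp_add]; simp
  set M : ℝ := 64 * (1 + |t|) ^ (1 / 4 : ℝ) with hM
  have hM0 : 0 < M := by positivity
  have hre : ∀ w ∈ Metric.ball c (3 / 2), (f w).re ≤ M := by
    intro w hw
    have h1 := hexp w hw
    have h2 := Z_bound (hball w hw).le
    rw [h1, norm_mul, Complex.norm_exp] at h2
    have hwc : ‖w - c‖ < 3 / 2 := by rwa [Metric.mem_ball, Complex.dist_eq] at hw
    have hcn : ‖c‖ ≤ 2 + |t| := by
      refine (norm_add_le _ _).trans ?_
      simp
    have hw1 : ‖w‖ ≤ 4 * (1 + |t|) := by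
      have : ‖w‖ ≤ ‖w - c‖ + ‖c‖ := by simpa using norm_add_le (w - c) c
      linarith [abs_nonneg t]
    have hw2 : ‖w - 1‖ ≤ 5 * (1 + |t|) := by
      have : ‖w - 1‖ ≤ ‖w‖ + 1 := by simpa using norm_sub_le w 1
      linarith [abs_nonneg t]
    have hexpb : Real.exp (f w).re ≤ 256 * (1 + |t|) ^ 2 := by
      have ht0 := abs_nonneg t
      have h3 : ‖w‖ * (1 + 2 * ‖w - 1‖) ≤ (4 * (1 + |t|)) * (1 + 2 * (5 * (1 + |t|))) := by gcongr
      have h4 : 1 / 4 * Real.exp (f w).re ≤ ‖riemannZeta₁ c‖ * Real.exp (f w).re := by gcongr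
      nlinarith
    have h5 : (f w).re ≤ Real.log (256 * (1 + |t|) ^ 2) := by
      rw [Real.le_log_iff_exp_le (by positivity)]; exact hexpb
    have h6 : Real.log (256 * (1 + |t|) ^ 2) = 8 * Real.log 2 + 2 * Real.log (1 + |t|) := by
      rw [Real.log_mul (by norm_num) (by positivity), Real.log_pow,
        show (256 : ℝ) = 2 ^ 8 by norm_num, Real.log_pow]; norm_num
    have h7 := Real.log_le_rpow_div (x := 1 + |t|) (by positivity) (ε := 1 / 4) (by norm_num)
    have h8 : 1 ≤ (1 + |t|) ^ (1 / 4 : ℝ) :=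
      Real.one_le_rpow (by linarith [abs_nonneg t]) (by norm_num)
    have h9 := Real.log_two_lt_d9
    rw [hM]
    linarith
  have hfd : DifferentiableOn ℂ f (Metric.ball c (3 / 2)) := fun w hw => (hf w hw).differentiableAt.differentiableWithinAt
  have hBC : ∀ w, ‖w - c‖ ≤ 3 / 2 - δ → ‖f w‖ ≤ 2 * M * (3 / 2) / δ := by
    intro w hw
    have hmap : ∀ z ∈ Metric.ball (0 : ℂ) (3 / 2), c + z ∈ Metric.ball c (3 / 2) := by
      intro z hz; simpa [Complex.dist_eq] using hz
    have := borelCaratheodory_zero (f := fun z => f (c + z)) (R := 3 / 2) (M := M) (z := w - c) hM0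
      (hfd.comp (by fun_prop) hmap) (fun z hz => hre _ (hmap z hz)) (by norm_num)
      (by rw [mem_ball_zero_iff]; linarith) (by simpa using hfc)
    simp only [add_sub_cancel] at this
    refine this.trans ?_
    gcongr
    · linarith
    · linarith
  have hsc : ‖s - c‖ ≤ 3 / 2 - 2 * δ := by
    have : s - c = ((s.re - 2 : ℝ) : ℂ) := by
      apply Complex.ext <;> simp [hc, ht]
    rw [this, Complex.norm_real]; exact hs
  have hsb : s ∈ Metric.ball c (3 / 2) := by rw [Metric.mem_ball, Complex.dist_eq]; linarith
  have hcb : Metric.closedBall s δ ⊆ Metric.closedBall c (3 / 2 - δ) := by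
    apply Metric.closedBall_subset_closedBall'
    rw [Complex.dist_eq]; linarith
  have hfin := Complex.norm_deriv_le_of_forall_mem_sphere_norm_le (c := s) (R := δ) (f := f) hδ
    (C := 2 * M * (3 / 2) / δ) ?_ ?_
  · rw [(hf s hsb).deriv] at hfin
    refine hfin.trans (le_of_eq ?_)
    rw [hM]; ring
  · apply DifferentiableOn.diffContOnCl
    rw [closure_ball _ hδ.ne']
    exact hfd.mono (hcb.trans (Metric.closedBall_subset_ball (by linarith)))
  · intro w hw
    have := hcb (Metric.sphere_subset_closedBall hw)
    rw [Metric.mem_closedBall, Complex.dist_eq] at this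
    exact hBC w this

open scoped FourierTransform SchwartzMap ContDiff in
theorem plancherel_L1L2 (f : ℝ → ℂ) (h1 : Integrable f) (h2 : MemLp f 2) :
    ∫ ξ, ‖𝓕 f ξ‖ ^ 2 = ∫ u, ‖f u‖ ^ 2 := by
  set F : Lp ℂ 2 (volume : Measure ℝ) := h2.toLp f with hF
  have hcont : Continuous (𝓕 f) :=
    VectorFourier.fourierIntegral_continuous Real.continuous_fourierChar
      (by fun_prop) h1
  have hae : ∀ᵐ ξ : ℝ, (𝓕 F : Lp ℂ 2 (volume : Measure ℝ)) ξ = 𝓕 f ξ := by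
    apply ae_eq_of_integral_contDiff_smul_eq
    · exact (Lp.memLp _).locallyIntegrable (by norm_num)
    · exact hcont.locallyIntegrable
    · intro g hg hgs
      let gc : ℝ → ℂ := fun x => (g x : ℂ)
      have hgc : ContDiff ℝ ∞ gc := Complex.ofRealCLM.contDiff.comp hg
      have hgcs : HasCompactSupport gc := hgs.comp_left (g := fun x : ℝ => (x : ℂ)) (by simp)
      let G : 𝓢(ℝ, ℂ) := hgcs.toSchwartzMap hgc
      have hG : ∀ x, G x = (g x : ℂ) := fun x => rfl
      have e1 := congrArg (fun T => T G) (MeasureTheory.Lp.fourier_toTemperedDistribution_eq F)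
      simp only [TemperedDistribution.fourier_apply, MeasureTheory.Lp.toTemperedDistribution_apply] at e1
      have e2 : ∫ x, (𝓕 G) x • F x = ∫ x, (𝓕 G) x • f x := by
        apply integral_congr_ae
        filter_upwards [h2.coeFn_toLp] with x hx
        rw [hF, hx]
      have e3 : ∫ ξ, (𝓕 (G : ℝ → ℂ) ξ) • f ξ = ∫ x, G x • 𝓕 f x := by
        have := VectorFourier.integral_fourierIntegral_smul_eq_flip (μ := volume) (L := innerₗ ℝ)
          Real.continuous_fourierChar (by fun_prop) (G.integrable (μ := volume)) h1
        rw [flip_innerₗ] at this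
        exact this
      rw [e2] at e1
      rw [SchwartzMap.fourier_coe, e3] at e1
      simp only [hG] at e1
      simpa using e1.symm
  have hn : ‖(𝓕 F : Lp ℂ 2 (volume : Measure ℝ))‖ ^ 2 = ‖F‖ ^ 2 := by rw [MeasureTheory.Lp.norm_fourier_eq]
  have key : ∀ H : Lp ℂ 2 (volume : Measure ℝ), ‖H‖ ^ 2 = ∫ x, ‖H x‖ ^ 2 := by
    intro H
    have := MeasureTheory.L2.inner_def (𝕜 := ℂ) H H
    rw [inner_self_eq_norm_sq_to_K] at this
    have h3 : ∫ a, inner ℂ (H a) (H a) = ((∫ x, ‖H x‖ ^ 2 : ℝ) : ℂ) := by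
      rw [← integral_complex_ofReal]
      congr 1; ext x; rw [inner_self_eq_norm_sq_to_K]; norm_cast
    rw [h3] at this
    apply Complex.ofReal_injective
    rw [← this]
    simp
  rw [key, key] at hn
  rw [integral_congr_ae (g := fun x => ‖f x‖ ^ 2) (f := fun x => ‖F x‖ ^ 2)] at hn
  · rw [← hn]
    apply integral_congr_ae
    filter_upwards [hae] with x hx
    rw [hx]
  · filter_upwards [h2.coeFn_toLp] with x hx
    rw [hF, hx]

theorem landau_mgf {Ω : Type*} [MeasurableSpace Ω] {μ : Measure Ω} (X : Ω → ℝ) (hX : Measurable X)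
    (hX0 : ∀ᵐ a ∂μ, X a ≤ 0) (h : ∀ σ : ℝ, 1 < σ → Integrable (fun a => Real.exp (σ * X a)) μ)
    (F : ℂ → ℂ) {r : ℝ} (hr : 0 < r) (hF : DifferentiableOn ℂ F (Metric.ball 2 r))
    (hFe : ∀ σ : ℝ, 1 < σ → (σ : ℂ) ∈ Metric.ball 2 r → F σ = ((∫ a, Real.exp (σ * X a) ∂μ : ℝ) : ℂ))
    {ρ : ℝ} (hρ : 0 ≤ ρ) (hρr : ρ < r) : Integrable (fun a => Real.exp ((2 - ρ) * X a)) μ := by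
  have hIntg : Ioi (1 : ℝ) ⊆ interior (ProbabilityTheory.integrableExpSet X μ) := by
    apply interior_maximal _ isOpen_Ioi
    intro σ hσ; exact h σ hσ
  have h2 : (2 : ℝ) ∈ interior (ProbabilityTheory.integrableExpSet X μ) := hIntg (by norm_num)
  have hA1 : AnalyticAt ℂ (ProbabilityTheory.complexMGF X μ) 2 :=
    ProbabilityTheory.analyticAt_complexMGF (by simpa using h2)
  have hA2 : AnalyticAt ℂ F 2 := hF.analyticAt (Metric.ball_mem_nhds _ hr)
  have hev : F =ᶠ[𝓝 2] ProbabilityTheory.complexMGF X μ := by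
    refine (hA2.frequently_eq_iff_eventually_eq hA1).mp ?_
    have ht : Tendsto (fun n : ℕ => (((2 + 1 / ((n : ℝ) + 1) : ℝ)) : ℂ)) atTop (𝓝[≠] 2) := by
      refine tendsto_nhdsWithin_iff.mpr ⟨?_, ?_⟩
      · have : Tendsto (fun n : ℕ => (2 + 1 / ((n : ℝ) + 1) : ℝ)) atTop (𝓝 (2 + 0)) :=
          tendsto_const_nhds.add tendsto_one_div_add_atTop_nhds_zero_nat
        rw [add_zero] at this
        have := (Complex.continuous_ofReal.tendsto (2 : ℝ)).comp this
        simpa [Function.comp_def] using this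
      · refine Eventually.of_forall fun n => ?_
        simp only [mem_compl_iff, mem_singleton_iff]
        intro hh
        have : (2 + 1 / ((n : ℝ) + 1) : ℝ) = 2 := by exact_mod_cast hh
        have : 0 < 1 / ((n : ℝ) + 1) := by positivity
        linarith
    refine ht.frequently (Eventually.frequently ?_)
    have hb := (tendsto_nhdsWithin_iff.mp ht).1.eventually (Metric.ball_mem_nhds (2 : ℂ) hr)
    filter_upwards [hb] with n hn
    have h1 : (1 : ℝ) < 2 + 1 / ((n : ℝ) + 1) := by
      have : 0 < 1 / ((n : ℝ) + 1) := by positivity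
      linarith
    rw [hFe _ h1 hn, ProbabilityTheory.complexMGF_ofReal]
    rfl
  have hder : ∀ n : ℕ, iteratedDeriv n F 2 = ((∫ a, X a ^ n * Real.exp (2 * X a) ∂μ : ℝ) : ℂ) := by
    intro n
    rw [hev.iteratedDeriv_eq, ProbabilityTheory.iteratedDeriv_complexMGF (by simpa using h2), ← integral_complex_ofReal]
    congr 1; ext a; push_cast; rfl
  have hs := Complex.hasSum_taylorSeries_on_ball (z := ((2 - ρ : ℝ) : ℂ)) hF (by
    rw [Metric.mem_ball, Complex.dist_eq]
    push_cast
    rw [show (2 - (ρ : ℂ) - 2) = ((-ρ : ℝ) : ℂ) by push_cast; ring, Complex.norm_real]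
    simpa [abs_of_nonneg hρ] using hρr)
  have hs2 : Summable (fun n : ℕ => ∫ a, (n.factorial : ℝ)⁻¹ * ((-ρ) * X a) ^ n * Real.exp (2 * X a) ∂μ) := by
    rw [← Complex.summable_ofReal]
    refine hs.summable.congr fun n => ?_
    rw [hder]
    simp only [mul_pow]
    have : ∀ a, (n.factorial : ℝ)⁻¹ * ((-ρ) ^ n * X a ^ n) * Real.exp (2 * X a) =
      ((n.factorial : ℝ)⁻¹ * (-ρ) ^ n) * (X a ^ n * Real.exp (2 * X a)) := by intro a; ring
    simp only [this]
    rw [integral_const_mul]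
    push_cast
    simp only [smul_eq_mul]
    ring
  have hI : ∀ n : ℕ, Integrable (fun a => (n.factorial : ℝ)⁻¹ * ((-ρ) * X a) ^ n * Real.exp (2 * X a)) μ := by
    intro n
    have := ProbabilityTheory.integrable_pow_mul_exp_of_mem_interior_integrableExpSet h2 n
    refine (this.const_mul ((n.factorial : ℝ)⁻¹ * (-ρ) ^ n)).congr (Eventually.of_forall fun a => ?_)
    simp only [mul_pow]; ring
  refine ⟨(by fun_prop : Measurable (fun a => Real.exp ((2 - ρ) * X a))).aestronglyMeasurable, ?_⟩
  rw [hasFiniteIntegral_iff_ofReal (Eventually.of_forall fun a => (Real.exp_pos _).le)]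
  have hnn : ∀ᵐ a ∂μ, ∀ n : ℕ, 0 ≤ (n.factorial : ℝ)⁻¹ * ((-ρ) * X a) ^ n * Real.exp (2 * X a) := by
    filter_upwards [hX0] with a ha n
    have : 0 ≤ (-ρ) * X a := by nlinarith
    positivity
  have e1 : ∫⁻ a, ENNReal.ofReal (Real.exp ((2 - ρ) * X a)) ∂μ =
      ∫⁻ a, ∑' n : ℕ, ENNReal.ofReal ((n.factorial : ℝ)⁻¹ * ((-ρ) * X a) ^ n * Real.exp (2 * X a)) ∂μ := by
    apply lintegral_congr_ae
    filter_upwards [hnn] with a ha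
    have hsum : HasSum (fun n : ℕ => (n.factorial : ℝ)⁻¹ * ((-ρ) * X a) ^ n * Real.exp (2 * X a))
        (Real.exp ((2 - ρ) * X a)) := by
      have h1 := (NormedSpace.expSeries_div_hasSum_exp (𝔸 := ℝ) ((-ρ) * X a)).mul_right (Real.exp (2 * X a))
      rw [← Real.exp_eq_exp_ℝ, ← Real.exp_add] at h1
      rw [show (2 - ρ) * X a = -ρ * X a + 2 * X a by ring]
      refine h1.congr_fun ?_
      intro n; simp only [div_eq_inv_mul]
    rw [← hsum.tsum_eq]
    exact ENNReal.ofReal_tsum_of_nonneg ha hsum.summable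
  rw [e1, lintegral_tsum (fun n => (hI n).1.aemeasurable.ennreal_ofReal)]
  have e2 : ∀ n : ℕ, ∫⁻ a, ENNReal.ofReal ((n.factorial : ℝ)⁻¹ * ((-ρ) * X a) ^ n * Real.exp (2 * X a)) ∂μ =
      ENNReal.ofReal (∫ a, (n.factorial : ℝ)⁻¹ * ((-ρ) * X a) ^ n * Real.exp (2 * X a) ∂μ) := by
    intro n
    rw [ofReal_integral_eq_lintegral_ofReal (hI n)]
    filter_upwards [hnn] with a ha using ha n
  simp only [e2]
  exact hs2.tsum_ofReal_lt_top

theorem psi_measurable : Measurable Chebyshev.psi := Chebyshev.psi_mono.measurable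

theorem psi_sub_bound {x : ℝ} (hx : 1 ≤ x) : |Chebyshev.psi x - x| ≤ (Real.log 4 + 5) * x := by
  have h1 := Chebyshev.psi_le_const_mul_self (x := x) (by linarith)
  have h2 := Chebyshev.psi_nonneg x
  have h3 : 0 ≤ Real.log 4 := Real.log_nonneg (by norm_num)
  rw [abs_le]
  constructor <;> nlinarith

theorem lin_integrable {s : ℝ} (hs : 1 < s) :
    IntegrableOn (fun x : ℝ => x * x ^ (-(s + 1))) (Ioi 1) := by
  refine (integrableOn_Ioi_rpow_of_lt (a := -s) (by linarith) zero_lt_one).congr_fun ?_ measurableSet_Ioi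
  intro x hx
  have hx : (1 : ℝ) < x := hx
  simp only
  rw [show -s = 1 + (-(s + 1)) by ring, Real.rpow_add (by linarith), Real.rpow_one]

theorem bdd_lin_integrable {f : ℝ → ℂ} {C : ℝ} (hm : Measurable f)
    (hb : ∀ x, 1 ≤ x → ‖f x‖ ≤ C * x) {s : ℂ} (hs : 1 < s.re) :
    IntegrableOn (fun x : ℝ => f x * (x : ℂ) ^ (-(s + 1))) (Ioi 1) := by
  refine Integrable.mono' ((lin_integrable hs).const_mul C) ?_ ?_
  · exact (hm.mul (by fun_prop)).aestronglyMeasurable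
  · filter_upwards [ae_restrict_mem measurableSet_Ioi] with x hx
    have hx : (1 : ℝ) < x := hx
    rw [norm_mul, Complex.norm_cpow_eq_rpow_re_of_pos (by linarith)]
    have := hb x hx.le
    have h2 : 0 ≤ x ^ (-(s.re + 1)) := by positivity
    simp only [neg_re, add_re, one_re]
    nlinarith

theorem K_formula {s : ℂ} (hs : 1 < s.re) :
    ∫ x in Ioi (1 : ℝ), ((Chebyshev.psi x - x : ℝ) : ℂ) * (x : ℂ) ^ (-(s + 1)) = -(LD s + 1) / s := by
  have hs0 : s ≠ 0 := by rintro rfl; norm_num at hs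
  have hs1 : s - 1 ≠ 0 := by
    intro h; rw [sub_eq_zero] at h; subst h; norm_num at hs
  have h1 : ∫ x in Ioi (1 : ℝ), ((Chebyshev.psi x - x : ℝ) : ℂ) * (x : ℂ) ^ (-(s + 1)) =
      (∫ x in Ioi (1 : ℝ), ((Chebyshev.psi x : ℝ) : ℂ) * (x : ℂ) ^ (-(s + 1))) -
      ∫ x in Ioi (1 : ℝ), (x : ℂ) * (x : ℂ) ^ (-(s + 1)) := by
    rw [← integral_sub]
    · congr 1; ext x; push_cast; ring
    · refine bdd_lin_integrable (C := Real.log 4 + 4) (f := fun x => ((Chebyshev.psi x : ℝ) : ℂ)) (Complex.measurable_ofReal.comp psi_measurable) ?_ hs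
      intro x hx
      rw [Complex.norm_real, Real.norm_of_nonneg (Chebyshev.psi_nonneg x)]
      exact Chebyshev.psi_le_const_mul_self (by linarith)
    · refine bdd_lin_integrable (C := 1) (f := fun x => (x : ℂ)) (by fun_prop) ?_ hs
      intro x hx
      rw [Complex.norm_real, Real.norm_of_nonneg (by linarith)]; linarith
  have h2 : ∫ x in Ioi (1 : ℝ), (x : ℂ) * (x : ℂ) ^ (-(s + 1)) = 1 / (s - 1) := by
    have : ∫ x in Ioi (1 : ℝ), (x : ℂ) * (x : ℂ) ^ (-(s + 1)) = ∫ x in Ioi (1 : ℝ), (x : ℂ) ^ (-s) := by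
      apply setIntegral_congr_fun measurableSet_Ioi
      intro x hx
      have hx : (1 : ℝ) < x := hx
      simp only
      rw [show -s = 1 + (-(s + 1)) by ring, Complex.cpow_add _ _ (by exact_mod_cast (by linarith : x ≠ 0)), Complex.cpow_one]
    rw [this, integral_Ioi_cpow_of_lt (by simpa using hs) zero_lt_one]
    simp
    rw [show -s + 1 = -(s - 1) by ring]
    field_simp
  have h3 : LSeries (fun n => ((ArithmeticFunction.vonMangoldt n : ℝ) : ℂ)) s =
      s * ∫ x in Ioi (1 : ℝ), ((Chebyshev.psi x : ℝ) : ℂ) * (x : ℂ) ^ (-(s + 1)) := by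
    rw [LSeries_eq_mul_integral_of_nonneg (fun n => ArithmeticFunction.vonMangoldt n) zero_le_one hs]
    · congr 1
      apply setIntegral_congr_fun measurableSet_Ioi
      intro x hx
      simp only
      rw [Chebyshev.psi]
      push_cast
      congr 1
    · refine Asymptotics.IsBigO.of_bound (Real.log 4 + 4) (Eventually.of_forall fun n => ?_)
      have : ∑ k ∈ Finset.Icc 1 n, ArithmeticFunction.vonMangoldt k = Chebyshev.psi n := by
        rw [Chebyshev.psi, Nat.floor_natCast]; congr 1
      rw [this, Real.norm_of_nonneg (Chebyshev.psi_nonneg _), Real.rpow_one, Real.norm_of_nonneg (by positivity)]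
      exact Chebyshev.psi_le_const_mul_self (by positivity)
    · intro n; exact ArithmeticFunction.vonMangoldt_nonneg
  have h4 : LSeries (fun n => ((ArithmeticFunction.vonMangoldt n : ℝ) : ℂ)) s = 1 / (s - 1) - LD s := by
    rw [ArithmeticFunction.LSeries_vonMangoldt_eq_deriv_riemannZeta_div hs]
    have hz : riemannZeta s = (s - 1)⁻¹ * riemannZeta₁ s := riemannZeta_eq_inv_sub_mul (by rwa [sub_ne_zero] at hs1)
    have hz0 := riemannZeta_ne_zero_of_one_lt_re hs
    have hZ0 : riemannZeta₁ s ≠ 0 := by intro h; rw [h, mul_zero] at hz; exact hz0 hz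
    have hd := deriv_riemannZeta_eq_neg_inv_sub_sq_mul_add (s := s) (by rwa [sub_ne_zero] at hs1)
    rw [hd, hz, LD]
    field_simp
    ring
  rw [h1, h2]
  have h5 : ∫ x in Ioi (1 : ℝ), ((Chebyshev.psi x : ℝ) : ℂ) * (x : ℂ) ^ (-(s + 1)) = (1 / (s - 1) - LD s) / s := by
    rw [← h4, h3]; field_simp
  rw [h5]
  field_simp
  ring

/-- The meromorphic kernel, holomorphic on `Re s > 1/2` under RH. -/
noncomputable def KK (s : ℂ) : ℂ := -(LD s + 1) / s

theorem KK_diff (hRH : RiemannHypothesis) : DifferentiableOn ℂ KK {s : ℂ | 1 / 2 < s.re} := by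
  unfold KK
  refine DifferentiableOn.div ((LD_diff hRH).add (differentiableOn_const _)).neg differentiableOn_id ?_
  intro s hs h
  have hs : 1 / 2 < s.re := hs
  have h : s = 0 := h
  rw [h] at hs; norm_num at hs

theorem KK_bound (hRH : RiemannHypothesis) {δ : ℝ} (hδ : 0 < δ) (hδ' : δ < 1 / 2) :
    ∃ C : ℝ, 0 < C ∧ ∀ s : ℂ, |s.re - 2| ≤ 3 / 2 - 2 * δ → ‖KK s‖ ≤ C * (1 + |s.im|) ^ (-(3 / 4) : ℝ) := by
  obtain ⟨C, hC, h⟩ := LD_bound hRH hδ hδ'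
  refine ⟨3 * (C + 1), by positivity, fun s hs => ?_⟩
  have h1 := h s hs
  have hre : 1 / 2 ≤ s.re := by
    have := (abs_le.mp hs).1; linarith
  have hn1 : 1 / 2 ≤ ‖s‖ := hre.trans (Complex.re_le_norm s)
  have hn2 : |s.im| ≤ ‖s‖ := Complex.abs_im_le_norm s
  have hT : 1 ≤ 1 + |s.im| := by linarith [abs_nonneg s.im]
  have hT0 : 0 < 1 + |s.im| := by linarith
  have hn3 : (1 + |s.im|) / 3 ≤ ‖s‖ := by linarith
  have h4 : (1 : ℝ) ≤ (1 + |s.im|) ^ (1 / 4 : ℝ) := Real.one_le_rpow hT (by norm_num)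
  have h5 : ‖LD s + 1‖ ≤ (C + 1) * (1 + |s.im|) ^ (1 / 4 : ℝ) := by
    calc ‖LD s + 1‖ ≤ ‖LD s‖ + ‖(1 : ℂ)‖ := norm_add_le _ _
      _ ≤ _ := by rw [norm_one]; linarith
  rw [KK, norm_div, norm_neg]
  calc ‖LD s + 1‖ / ‖s‖ ≤ (C + 1) * (1 + |s.im|) ^ (1 / 4 : ℝ) / ((1 + |s.im|) / 3) := by
        gcongr
    _ = 3 * (C + 1) * ((1 + |s.im|) ^ (1 / 4 : ℝ) / (1 + |s.im|) ^ (1 : ℝ)) := by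
        rw [Real.rpow_one]; field_simp
    _ = _ := by rw [← Real.rpow_sub hT0]; norm_num

theorem KK_conj {s : ℂ} (hs : 1 < s.re) : KK ((starRingEnd ℂ) s) = (starRingEnd ℂ) (KK s) := by
  rw [KK, ← K_formula (by simpa using hs), KK, ← K_formula hs, ← integral_conj]
  apply setIntegral_congr_fun measurableSet_Ioi
  intro x hx
  have hx : (1 : ℝ) < x := hx
  simp only [map_mul, conj_ofReal]
  congr 1
  have := Complex.cpow_conj (x : ℂ) (-(s + 1)) (by
    rw [Complex.arg_ofReal_of_nonneg (by linarith)]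
    exact Real.pi_pos.ne)
  rw [conj_ofReal] at this
  rw [← this]
  simp

theorem FF_diff (hRH : RiemannHypothesis) {δ : ℝ} (hδ : 0 < δ) (hδ' : δ < 1 / 2) :
    DifferentiableOn ℂ (fun z : ℂ => ∫ ξ : ℝ, KK (z + 2 * Real.pi * ξ * I) * KK (z - 2 * Real.pi * ξ * I))
      (Metric.ball 2 (3 / 2 - 2 * δ)) := by
  obtain ⟨C, hC, h⟩ := KK_bound hRH hδ hδ'
  have hball : ∀ z ∈ Metric.ball (2 : ℂ) (3 / 2 - 2 * δ), |z.re - 2| ≤ 3 / 2 - 2 * δ ∧ |z.im| ≤ 3 / 2 := by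
    intro z hz
    rw [Metric.mem_ball, Complex.dist_eq] at hz
    have h1 := Complex.abs_re_le_norm (z - 2)
    have h2 := Complex.abs_im_le_norm (z - 2)
    simp at h1 h2
    exact ⟨by linarith, by linarith⟩
  have hre : ∀ z ∈ Metric.ball (2 : ℂ) (3 / 2 - 2 * δ), 1 / 2 < z.re := by
    intro z hz
    have := (abs_le.mp (hball z hz).1).1; linarith
  have hKat : ∀ s : ℂ, 1 / 2 < s.re → DifferentiableAt ℂ KK s := fun s hs =>
    (KK_diff hRH).differentiableAt ((isOpen_lt continuous_const continuous_re).mem_nhds hs)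
  have hIntg : Integrable (fun ξ : ℝ => C ^ 2 * (2 / 5 : ℝ) ^ (-(3 / 2) : ℝ) * (1 + ‖ξ‖) ^ (-(3 / 2) : ℝ)) :=
    (integrable_one_add_norm (by simp; norm_num)).const_mul _
  refine holo_integral Metric.isOpen_ball _ _ hIntg ?_ ?_ ?_
  · intro z hz
    have hz' := hre z hz
    apply Continuous.aestronglyMeasurable
    apply Continuous.mul
    · rw [continuous_iff_continuousAt]
      intro ξ
      have : ContinuousAt KK (z + 2 * Real.pi * ξ * I) := (hKat _ (by simpa using hz')).continuousAt
      exact ContinuousAt.comp (f := fun ξ : ℝ => z + 2 * Real.pi * ξ * I) this (by fun_prop)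
    · rw [continuous_iff_continuousAt]
      intro ξ
      have : ContinuousAt KK (z - 2 * Real.pi * ξ * I) := (hKat _ (by simpa using hz')).continuousAt
      exact ContinuousAt.comp (f := fun ξ : ℝ => z - 2 * Real.pi * ξ * I) this (by fun_prop)
  · refine Eventually.of_forall fun ξ => ?_
    intro z hz
    have hz' := hre z hz
    apply DifferentiableAt.differentiableWithinAt
    apply DifferentiableAt.mul
    · exact DifferentiableAt.comp (f := fun z : ℂ => z + 2 * Real.pi * ξ * I) z (hKat _ (by simpa using hz')) (by fun_prop)
    · exact DifferentiableAt.comp (f := fun z : ℂ => z - 2 * Real.pi * ξ * I) z (hKat _ (by simpa using hz')) (by fun_prop)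
  · refine Eventually.of_forall fun ξ => ?_
    intro z hz
    obtain ⟨hz1, hz2⟩ := hball z hz
    have key : ∀ t : ℝ, |2 * Real.pi * ξ| - 3 / 2 ≤ |t| → (2 / 5) * (1 + ‖ξ‖) ≤ 1 + |t| := by
      intro t ht
      have h3 := Real.pi_gt_three
      rw [abs_mul, abs_of_pos (by positivity : 0 < 2 * Real.pi)] at ht
      rw [Real.norm_eq_abs]
      have := abs_nonneg ξ
      have := abs_nonneg t
      have h6 : 6 * |ξ| ≤ 2 * Real.pi * |ξ| := by nlinarith
      by_cases hc : |ξ| ≤ 3 / 2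
      · linarith
      · push Not at hc; linarith
    have b : ∀ s : ℂ, s.re = z.re → |2 * Real.pi * ξ| - 3 / 2 ≤ |s.im| →
        ‖KK s‖ ≤ C * ((2 / 5) * (1 + ‖ξ‖)) ^ (-(3 / 4) : ℝ) := by
      intro s hs1 hs2
      refine (h s (by rw [hs1]; exact hz1)).trans ?_
      have := key _ hs2
      refine mul_le_mul_of_nonneg_left ?_ hC.le
      exact Real.rpow_le_rpow_of_nonpos (by positivity) this (by norm_num)
    have b1 := b (z + 2 * Real.pi * ξ * I) (by simp) (by
      have : (z + 2 * Real.pi * ξ * I).im = z.im + 2 * Real.pi * ξ := by simp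
      rw [this]
      have := abs_sub_abs_le_abs_sub (2 * Real.pi * ξ) (-z.im)
      rw [abs_neg, sub_neg_eq_add, add_comm (2 * Real.pi * ξ)] at this
      linarith)
    have b2 := b (z - 2 * Real.pi * ξ * I) (by simp) (by
      have : (z - 2 * Real.pi * ξ * I).im = z.im - 2 * Real.pi * ξ := by simp
      rw [this]
      have := abs_sub_abs_le_abs_sub (2 * Real.pi * ξ) (z.im)
      rw [abs_sub_comm] at this
      linarith)
    rw [norm_mul]
    have hp : 0 < 2 / 5 * (1 + ‖ξ‖) := by positivity
    calc _ ≤ (C * ((2 / 5) * (1 + ‖ξ‖)) ^ (-(3 / 4) : ℝ)) * (C * ((2 / 5) * (1 + ‖ξ‖)) ^ (-(3 / 4) : ℝ)) := by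
          gcongr
      _ = C ^ 2 * (((2 / 5) * (1 + ‖ξ‖)) ^ (-(3 / 4) : ℝ) * ((2 / 5) * (1 + ‖ξ‖)) ^ (-(3 / 4) : ℝ)) := by ring
      _ = _ := by
          rw [← Real.rpow_add hp, show (-(3 / 4) + -(3 / 4) : ℝ) = -(3 / 2) by norm_num,
            Real.mul_rpow (by norm_num) (by positivity), mul_assoc]

/-- The truncated error term of the Chebyshev function. -/
noncomputable def fpsi (x : ℝ) : ℂ := (Ioi (1 : ℝ)).indicator (fun x => ((Chebyshev.psi x - x : ℝ) : ℂ)) x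

theorem fpsi_measurable : Measurable fpsi := by
  unfold fpsi
  refine Measurable.indicator ?_ measurableSet_Ioi
  exact Complex.measurable_ofReal.comp (psi_measurable.sub measurable_id)

theorem fpsi_exp_zero {u : ℝ} (hu : 0 ≤ u) : fpsi (Real.exp (-u)) = 0 := by
  unfold fpsi
  rw [indicator_of_notMem]
  simp only [mem_Ioi, not_lt, Real.exp_le_one_iff]; linarith

theorem fpsi_exp_bound (u : ℝ) : ‖fpsi (Real.exp (-u))‖ ≤ (Real.log 4 + 5) * Real.exp (-u) := by
  have h3 : 0 ≤ Real.log 4 := Real.log_nonneg (by norm_num)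
  by_cases hu : 0 ≤ u
  · rw [fpsi_exp_zero hu, norm_zero]; positivity
  · push Not at hu
    have h1 : 1 < Real.exp (-u) := by rw [Real.one_lt_exp_iff]; linarith
    unfold fpsi
    rw [indicator_of_mem (mem_Ioi.mpr h1), Complex.norm_real, Real.norm_eq_abs]
    exact psi_sub_bound h1.le

theorem exp_Iic_integrable {a : ℝ} (ha : 0 < a) :
    Integrable (fun u : ℝ => (Iio (0 : ℝ)).indicator (fun u => Real.exp (a * u)) u) := by
  rw [integrable_indicator_iff measurableSet_Iio]
  have h : IntegrableOn (fun x : ℝ => ‖Complex.exp (a * x)‖) (Iic 0) := (integrableOn_exp_mul_complex_Iic (a := (a : ℂ)) (by simpa using ha) 0).norm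
  refine (h.mono_set Iio_subset_Iic_self).congr_fun ?_ measurableSet_Iio
  intro u _
  simp [Complex.norm_exp]

/-- The exponentially weighted error term in the logarithmic variable. -/
noncomputable def gg (σ u : ℝ) : ℂ := Real.exp (σ * u) • fpsi (Real.exp (-u))

theorem gg_measurable (σ : ℝ) : Measurable (gg σ) := by
  unfold gg
  exact (by fun_prop : Measurable fun u : ℝ => Real.exp (σ * u)).smul (fpsi_measurable.comp (by fun_prop))

theorem gg_bound (σ u : ℝ) : ‖gg σ u‖ ≤
    (Real.log 4 + 5) * (Iio (0 : ℝ)).indicator (fun u => Real.exp ((σ - 1) * u)) u := by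
  by_cases hu : u < 0
  · rw [indicator_of_mem (mem_Iio.mpr hu), gg, norm_smul, Real.norm_of_nonneg (Real.exp_pos _).le]
    have := fpsi_exp_bound u
    have he := Real.exp_pos (σ * u)
    calc _ ≤ Real.exp (σ * u) * ((Real.log 4 + 5) * Real.exp (-u)) := by gcongr
      _ = _ := by rw [show (σ - 1) * u = σ * u + -u by ring, Real.exp_add]; ring
  · rw [indicator_of_notMem (by simpa using hu), gg, fpsi_exp_zero (by simpa using hu)]
    simp

theorem gg_integrable {σ : ℝ} (hσ : 1 < σ) : Integrable (gg σ) :=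
  Integrable.mono' ((exp_Iic_integrable (a := σ - 1) (by linarith)).const_mul _)
    (gg_measurable σ).aestronglyMeasurable (Eventually.of_forall (gg_bound σ))

theorem gg_sq_integrable {σ : ℝ} (hσ : 1 < σ) : Integrable (fun u => ‖gg σ u‖ ^ 2) := by
  refine Integrable.mono' (((exp_Iic_integrable (a := 2 * (σ - 1)) (by linarith)).const_mul ((Real.log 4 + 5) ^ 2)))
    ((gg_measurable σ).norm.pow_const 2).aestronglyMeasurable (Eventually.of_forall fun u => ?_)
  rw [Real.norm_of_nonneg (by positivity)]
  calc _ ≤ ((Real.log 4 + 5) * (Iio (0 : ℝ)).indicator (fun u => Real.exp ((σ - 1) * u)) u) ^ 2 := by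
        gcongr; exact gg_bound σ u
    _ = _ := by
      rw [mul_pow]
      congr 1
      by_cases hu : u ∈ Iio (0 : ℝ)
      · rw [indicator_of_mem hu, indicator_of_mem hu, ← Real.exp_nat_mul]
        congr 1; push_cast; ring
      · rw [indicator_of_notMem hu, indicator_of_notMem hu]; norm_num

open scoped FourierTransform in
theorem gg_fourier {σ : ℝ} (hσ : 1 < σ) (ξ : ℝ) : 𝓕 (gg σ) ξ = KK (σ - 2 * Real.pi * ξ * I) := by
  have hs : 1 < ((σ : ℂ) - 2 * Real.pi * ξ * I).re := by simpa using hσ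
  rw [KK, ← K_formula hs]
  have h := mellin_eq_fourier fpsi (s := -((σ : ℂ) - 2 * Real.pi * ξ * I))
  have e1 : (-((σ : ℂ) - 2 * Real.pi * ξ * I)).re = -σ := by simp
  have e2 : (-((σ : ℂ) - 2 * Real.pi * ξ * I)).im = 2 * Real.pi * ξ := by simp
  rw [e1, e2, mul_div_cancel_left₀ _ (by positivity), neg_neg] at h
  change mellin fpsi _ = 𝓕 (gg σ) ξ at h
  rw [← h, mellin]
  have : ∀ t : ℝ, ((t : ℂ) ^ (-((σ : ℂ) - 2 * Real.pi * ξ * I) - 1)) • fpsi t = (Ioi (1 : ℝ)).indicator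
      (fun x => ((Chebyshev.psi x - x : ℝ) : ℂ) * (x : ℂ) ^ (-(((σ : ℂ) - 2 * Real.pi * ξ * I) + 1))) t := by
    intro t
    rw [fpsi]
    by_cases ht : t ∈ Ioi (1 : ℝ)
    · rw [indicator_of_mem ht, indicator_of_mem ht, smul_eq_mul, mul_comm]
      congr 2; ring
    · rw [indicator_of_notMem ht, indicator_of_notMem ht, smul_zero]
  simp only [this]
  rw [setIntegral_indicator measurableSet_Ioi]
  congr 2
  rw [inter_eq_right]
  exact Ioi_subset_Ioi zero_le_one

theorem FF_eq {σ : ℝ} (hσ : 1 < σ) :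
    ∫ ξ : ℝ, KK (σ + 2 * Real.pi * ξ * I) * KK (σ - 2 * Real.pi * ξ * I) =
      ((∫ u, ‖gg σ u‖ ^ 2 : ℝ) : ℂ) := by
  rw [← plancherel_L1L2 (gg σ) (gg_integrable hσ) ((memLp_two_iff_integrable_sq_norm
    (gg_measurable σ).aestronglyMeasurable).mpr (gg_sq_integrable hσ)), ← integral_complex_ofReal]
  congr 1; ext ξ
  rw [gg_fourier hσ]
  have hs : 1 < ((σ : ℂ) - 2 * Real.pi * ξ * I).re := by simpa using hσ
  have h1 := KK_conj hs
  have e : (starRingEnd ℂ) ((σ : ℂ) - 2 * Real.pi * ξ * I) = (σ : ℂ) + 2 * Real.pi * ξ * I := by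
    have : (starRingEnd ℂ) 2 = 2 := Complex.conj_ofNat 2
    simp [map_sub, map_mul, conj_ofReal, this]
  rw [e] at h1
  rw [h1, mul_comm, Complex.mul_conj, Complex.normSq_eq_norm_sq]

theorem gg_sq_integrable_half (hRH : RiemannHypothesis) {σ : ℝ} (hσ : 1 / 2 < σ) (hσ' : σ ≤ 1) :
    Integrable (fun u => ‖gg σ u‖ ^ 2) := by
  have hm : Measurable (fun u : ℝ => (‖fpsi (Real.exp (-u))‖ ^ 2).toNNReal) := by
    refine Measurable.real_toNNReal ((Measurable.norm (fpsi_measurable.comp (by fun_prop))).pow_const 2)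
  have hsm : ∀ τ u : ℝ, (‖fpsi (Real.exp (-u))‖ ^ 2).toNNReal • Real.exp (τ * (2 * u)) = ‖gg τ u‖ ^ 2 := by
    intro τ u
    rw [NNReal.smul_def, Real.coe_toNNReal _ (by positivity), gg, norm_smul,
      Real.norm_of_nonneg (Real.exp_pos _).le, mul_pow, ← Real.exp_nat_mul, smul_eq_mul, mul_comm]
    congr 2; push_cast; ring
  have hi : ∀ τ : ℝ, Integrable (fun u : ℝ => Real.exp (τ * (2 * u)))
      (volume.withDensity fun u => (((‖fpsi (Real.exp (-u))‖ ^ 2).toNNReal : NNReal) : ENNReal)) ↔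
      Integrable (fun u => ‖gg τ u‖ ^ 2) := by
    intro τ
    rw [integrable_withDensity_iff_integrable_smul hm]
    simp only [hsm]
  have hδ : 0 < (σ - 1 / 2) / 4 := by linarith
  have hδ' : (σ - 1 / 2) / 4 < 1 / 2 := by linarith
  have := landau_mgf (μ := volume.withDensity fun u => (((‖fpsi (Real.exp (-u))‖ ^ 2).toNNReal : NNReal) : ENNReal))
    (fun u : ℝ => 2 * u) (by fun_prop) (by
      rw [ae_withDensity_iff hm.coe_nnreal_ennreal]
      refine Eventually.of_forall fun u hu => ?_
      by_contra hc
      push Not at hc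
      apply hu
      rw [fpsi_exp_zero (by linarith)]
      simp) (fun τ hτ => (hi τ).mpr (gg_sq_integrable hτ)) _
    (r := 3 / 2 - 2 * ((σ - 1 / 2) / 4)) (by linarith) (FF_diff hRH hδ hδ') (by
      intro τ hτ _
      rw [integral_withDensity_eq_integral_smul hm]
      simp only [hsm]
      exact FF_eq hτ) (ρ := 2 - σ) (by linarith) (by linarith)
  rw [← hi]
  simpa using this

theorem gg_integrable_half (hRH : RiemannHypothesis) {σ : ℝ} (hσ : 1 / 2 < σ) (hσ' : σ ≤ 1) :
    Integrable (gg σ) := by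
  obtain ⟨τ, h1, h2⟩ := exists_between hσ
  have hi := (gg_sq_integrable_half hRH h1 (by linarith)).add
    (exp_Iic_integrable (a := 2 * (σ - τ)) (by linarith))
  refine Integrable.mono' hi (gg_measurable σ).aestronglyMeasurable (Eventually.of_forall fun u => ?_)
  simp only [Pi.add_apply]
  by_cases hu : u ∈ Iio (0 : ℝ)
  · rw [indicator_of_mem hu]
    have e1 : ‖gg σ u‖ = ‖gg τ u‖ * Real.exp ((σ - τ) * u) := by
      rw [gg, gg, norm_smul, norm_smul, Real.norm_of_nonneg (Real.exp_pos _).le,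
        Real.norm_of_nonneg (Real.exp_pos _).le, show σ * u = τ * u + (σ - τ) * u by ring, Real.exp_add]
      ring
    have e2 : Real.exp (2 * (σ - τ) * u) = Real.exp ((σ - τ) * u) ^ 2 := by
      rw [← Real.exp_nat_mul]; congr 1; push_cast; ring
    rw [e1, e2]
    nlinarith [sq_nonneg (‖gg τ u‖ - Real.exp ((σ - τ) * u)), sq_nonneg (‖gg τ u‖), sq_nonneg (Real.exp ((σ - τ) * u))]
  · rw [indicator_of_notMem hu, gg, fpsi_exp_zero (by simpa using hu)]
    simp only [smul_zero, norm_zero]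
    positivity

theorem psi_L1 (hRH : RiemannHypothesis) {σ : ℝ} (hσ : 1 / 2 < σ) :
    IntegrableOn (fun x : ℝ => |Chebyshev.psi x - x| * x ^ (-(σ + 1))) (Ioi 1) := by
  rcases le_or_gt σ 1 with h | h
  · have hg := (gg_integrable_half hRH hσ h).norm
    have hder : ∀ x ∈ (univ : Set ℝ), HasDerivWithinAt (fun u : ℝ => Real.exp (-u)) (-Real.exp (-x)) univ x := by
      intro x _
      have := ((Real.hasDerivAt_exp (-x)).comp x (hasDerivAt_neg x)).hasDerivWithinAt (s := univ)
      simpa [Function.comp_def] using this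
    have hinj : InjOn (fun u : ℝ => Real.exp (-u)) univ := by
      intro a _ b _ hab
      simpa using hab
    have himg : (fun u : ℝ => Real.exp (-u)) '' univ = Ioi 0 := by
      ext y
      simp only [image_univ, mem_range, mem_Ioi]
      constructor
      · rintro ⟨u, rfl⟩; exact Real.exp_pos _
      · intro hy; exact ⟨-Real.log y, by rw [neg_neg, Real.exp_log hy]⟩
    have key := (integrableOn_image_iff_integrableOn_abs_deriv_smul MeasurableSet.univ hder hinj
      (fun x : ℝ => ‖fpsi x‖ * x ^ (-(σ + 1)))).mpr (by
        rw [integrableOn_univ]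
        refine hg.congr (Eventually.of_forall fun u => ?_)
        simp only
        rw [gg, norm_smul, Real.norm_of_nonneg (Real.exp_pos _).le, abs_neg, abs_of_pos (Real.exp_pos _),
          smul_eq_mul, ← Real.exp_mul, mul_comm ‖_‖, ← mul_assoc, ← Real.exp_add]
        congr 2; ring)
    rw [himg] at key
    refine (key.mono_set (Ioi_subset_Ioi zero_le_one)).congr_fun ?_ measurableSet_Ioi
    intro x hx
    simp only
    rw [fpsi, indicator_of_mem hx, Complex.norm_real, Real.norm_eq_abs]
  · refine Integrable.mono' ((lin_integrable h).const_mul (Real.log 4 + 5)) ?_ ?_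
    · have : Measurable (fun x : ℝ => |Chebyshev.psi x - x|) := (psi_measurable.sub measurable_id).abs
      exact (this.mul (by fun_prop)).aestronglyMeasurable
    · filter_upwards [ae_restrict_mem measurableSet_Ioi] with x hx
      have hx : (1 : ℝ) < x := hx
      have h0 : 0 ≤ x ^ (-(σ + 1)) := by positivity
      rw [Real.norm_of_nonneg (by positivity), ← mul_assoc]
      exact mul_le_mul_of_nonneg_right (psi_sub_bound hx.le) h0

theorem theta_L1 (hRH : RiemannHypothesis) {σ : ℝ} (hσ : 1 / 2 < σ) :
    IntegrableOn (fun x : ℝ => (|Chebyshev.theta x - x| + Real.log x) * x ^ (-(σ + 1))) (Ioi 1) := by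
  set ε := (σ - 1 / 2) / 2 with hε
  have hε0 : 0 < ε := by rw [hε]; linarith
  have h1 : IntegrableOn (fun x : ℝ => 3 / ε * x ^ (-1 - ε)) (Ioi 1) :=
    (integrableOn_Ioi_rpow_of_lt (a := -1 - ε) (by linarith) zero_lt_one).const_mul _
  have h2 := (psi_L1 hRH hσ).add h1
  refine Integrable.mono' h2 ?_ ?_
  · have : Measurable (fun x : ℝ => |Chebyshev.theta x - x| + Real.log x) :=
      (Chebyshev.theta_mono.measurable.sub measurable_id).abs.add Real.measurable_log
    exact (this.mul (by fun_prop)).aestronglyMeasurable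
  · filter_upwards [ae_restrict_mem measurableSet_Ioi] with x hx
    have hx : (1 : ℝ) < x := hx
    have hx0 : 0 < x := by linarith
    have hl : 0 ≤ Real.log x := Real.log_nonneg hx.le
    have hp : 0 ≤ x ^ (-(σ + 1)) := by positivity
    rw [Real.norm_of_nonneg (by positivity)]
    simp only [Pi.add_apply]
    have a1 := Chebyshev.abs_psi_sub_theta_le_sqrt_mul_log hx.le
    have a2 : |Chebyshev.theta x - x| ≤ |Chebyshev.psi x - x| + |Chebyshev.psi x - Chebyshev.theta x| := by
      have := abs_sub_le (Chebyshev.theta x) (Chebyshev.psi x) x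
      rw [abs_sub_comm (Chebyshev.theta x) (Chebyshev.psi x)] at this
      linarith
    have a3 : 1 ≤ √x := Real.one_le_sqrt.mpr hx.le
    have a4 : Real.log x ≤ √x * Real.log x := by nlinarith
    have a5 : Real.log x ≤ x ^ ε / ε := Real.log_le_rpow_div hx0.le hε0
    have a6 : |Chebyshev.theta x - x| + Real.log x ≤ |Chebyshev.psi x - x| + 3 * (√x * (x ^ ε / ε)) := by
      have : √x * Real.log x ≤ √x * (x ^ ε / ε) := by gcongr
      linarith
    calc _ ≤ (|Chebyshev.psi x - x| + 3 * (√x * (x ^ ε / ε))) * x ^ (-(σ + 1)) := by gcongr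
      _ = |Chebyshev.psi x - x| * x ^ (-(σ + 1)) + 3 / ε * (x ^ (1 / 2 : ℝ) * x ^ ε * x ^ (-(σ + 1))) := by
        rw [Real.sqrt_eq_rpow]; ring
      _ = _ := by
        rw [← Real.rpow_add hx0, ← Real.rpow_add hx0]
        congr 3
        rw [hε]; ring

/-- A unit vector in the direction of `v`. -/
noncomputable def dir (v : ℂ) : ℂ := if v = 0 then 1 else v / ‖v‖

theorem norm_dir (v : ℂ) : ‖dir v‖ = 1 := by
  unfold dir
  split_ifs with h
  · simp
  · rw [norm_div, Complex.norm_real, norm_norm, div_self (norm_ne_zero_iff.mpr h)]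

theorem dir_mul (v : ℂ) : v = ‖v‖ * dir v := by
  unfold dir
  split_ifs with h
  · simp [h]
  · have : (‖v‖ : ℂ) ≠ 0 := by exact_mod_cast norm_ne_zero_iff.mpr h
    field_simp

/-- Greedy partial sums following the target `τ`. -/
noncomputable def greedy (τ : ℕ → ℂ) : ℕ → ℂ
  | 0 => 0
  | n + 1 => greedy τ n + if (n + 1).Prime then dir (τ (n + 1) - greedy τ n) * (Real.log ((n + 1 : ℕ) : ℝ) : ℂ) else 0

theorem greedy_bound (τ : ℕ → ℂ) (h0 : τ 0 = 0)
    (hp : ∀ n, (n + 1).Prime → ‖τ (n + 1) - τ n‖ ≤ Real.log ((n + 1 : ℕ) : ℝ))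
    (hnp : ∀ n, ¬ (n + 1).Prime → τ (n + 1) = τ n) (n : ℕ) : ‖greedy τ n - τ n‖ ≤ Real.log n := by
  induction n with
  | zero => simp [greedy, h0]
  | succ n ih =>
    have hmono : Real.log n ≤ Real.log ((n + 1 : ℕ) : ℝ) := by
      rcases Nat.eq_zero_or_pos n with rfl | hn
      · simp
      · apply Real.log_le_log (by exact_mod_cast hn)
        push_cast; linarith
    by_cases h : (n + 1).Prime
    · rw [greedy, if_pos h]
      set v := τ (n + 1) - greedy τ n with hv
      set L := Real.log ((n + 1 : ℕ) : ℝ) with hL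
      have hL0 : 0 ≤ L := Real.log_natCast_nonneg _
      have e : greedy τ n + dir v * (L : ℂ) - τ (n + 1) = ((L - ‖v‖ : ℝ) : ℂ) * dir v := by
        have := dir_mul v
        calc _ = dir v * L - v := by rw [hv]; ring
          _ = dir v * L - ‖v‖ * dir v := by rw [← this]
          _ = _ := by push_cast; ring
      rw [e, norm_mul, norm_dir, mul_one, Complex.norm_real, Real.norm_eq_abs]
      have hv2 : ‖v‖ ≤ L + Real.log n := by
        calc ‖v‖ = ‖(τ (n + 1) - τ n) - (greedy τ n - τ n)‖ := by rw [hv]; congr 1; ring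
          _ ≤ _ := norm_sub_le _ _
          _ ≤ _ := add_le_add (hp n h) ih
      rw [abs_le]
      constructor <;> linarith [norm_nonneg v]
    · rw [greedy, if_neg h, add_zero, hnp n h]
      exact ih.trans hmono

/-- Completely multiplicative extension of prime values. -/
noncomputable def cmul (c : ℕ → ℂ) (n : ℕ) : ℂ :=
  if n = 0 then 0 else n.factorization.prod fun p k => c p ^ k

theorem cmul_mul (c : ℕ → ℂ) (m n : ℕ) : cmul c (m * n) = cmul c m * cmul c n := by
  unfold cmul
  by_cases hm : m = 0
  · simp [hm]
  by_cases hn : n = 0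
  · simp [hn]
  rw [if_neg hm, if_neg hn, if_neg (mul_ne_zero hm hn), Nat.factorization_mul hm hn,
    Finsupp.prod_add_index']
  · simp
  · intro a b1 b2; exact pow_add _ _ _

theorem cmul_norm (c : ℕ → ℂ) (hc : ∀ n, ‖c n‖ = 1) (n : ℕ) (hn : 1 ≤ n) : ‖cmul c n‖ = 1 := by
  unfold cmul
  rw [if_neg (by omega), Finsupp.prod, norm_prod]
  apply Finset.prod_eq_one
  intro p _
  rw [norm_pow, hc, one_pow]

theorem cmul_prime (c : ℕ → ℂ) {p : ℕ} (hp : p.Prime) : cmul c p = c p := by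
  unfold cmul
  rw [if_neg hp.ne_zero, hp.factorization, Finsupp.prod_single_index] <;> simp

theorem theta_succ (n : ℕ) : Chebyshev.theta ((n + 1 : ℕ) : ℝ) =
    Chebyshev.theta (n : ℝ) + if (n + 1).Prime then Real.log ((n + 1 : ℕ) : ℝ) else 0 := by
  rw [Chebyshev.theta, Chebyshev.theta, Nat.floor_natCast, Nat.floor_natCast, Finset.sum_filter, Finset.sum_filter]
  exact Finset.sum_Ioc_succ_top (Nat.zero_le n) _

theorem chi_exists (Q : ℝ → ℂ) (hQ : ∀ x y, ‖Q x - Q y‖ ≤ |x - y|) (hQ0 : Q 0 = 0) :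
    ∃ χ : ℕ → ℂ, χ 1 = 1 ∧ (∀ m n : ℕ, χ (m * n) = χ m * χ n) ∧
      (∀ n : ℕ, 1 ≤ n → ‖χ n‖ = 1) ∧
      ∀ n : ℕ, ‖(∑ k ∈ Finset.Icc 1 n, if k.Prime then χ k * (Real.log k : ℂ) else 0) +
        Q (Chebyshev.theta n)‖ ≤ Real.log n := by
  set τ : ℕ → ℂ := fun n => -Q (Chebyshev.theta n) with hτ
  set c : ℕ → ℂ := fun p => dir (τ p - greedy τ (p - 1)) with hc
  refine ⟨cmul c, by simp [cmul], cmul_mul c, cmul_norm c (fun n => norm_dir _), ?_⟩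
  have hsum : ∀ n : ℕ, (∑ k ∈ Finset.Icc 1 n, if k.Prime then cmul c k * (Real.log k : ℂ) else 0) = greedy τ n := by
    intro n
    induction n with
    | zero => simp [greedy]
    | succ n ih =>
      rw [Finset.sum_Icc_succ_top (by omega), ih, greedy]
      congr 1
      split_ifs with h
      · rw [cmul_prime c h, hc]
        simp only [Nat.add_sub_cancel]
      · rfl
  intro n
  rw [hsum]
  have hb := greedy_bound τ (by simp [hτ, hQ0]) ?_ ?_ n
  · simpa [hτ] using hb
  · intro m hm
    simp only [hτ]
    have h1 := hQ (Chebyshev.theta m) (Chebyshev.theta ((m + 1 : ℕ) : ℝ))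
    rw [neg_sub_neg]
    refine h1.trans (le_of_eq ?_)
    rw [theta_succ, if_pos hm, sub_add_cancel_left, abs_neg,
      abs_of_nonneg (Real.log_natCast_nonneg _)]
  · intro m hm
    simp only [hτ]
    rw [theta_succ, if_neg hm, add_zero]

theorem fubini_Q (r : ℝ → ℂ) (hr : AEStronglyMeasurable r volume) (hb : ∀ x, ‖r x‖ ≤ 1)
    (hz : ∀ x, x ≤ 1 → r x = 0) {s : ℂ} (hs : 1 < s.re) :
    s * ∫ x in Ioi (1 : ℝ), (∫ t in (0 : ℝ)..x, r t) * (x : ℂ) ^ (-(s + 1)) =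
      ∫ t in Ioi (1 : ℝ), r t * (t : ℂ) ^ (-s) := by
  have hs0 : s ≠ 0 := by rintro rfl; norm_num at hs
  set Φ : ℝ × ℝ → ℂ := fun z => {z : ℝ × ℝ | z.2 < z.1}.indicator (fun z => r z.2 * (z.1 : ℂ) ^ (-(s + 1))) z with hΦ
  have hmS : MeasurableSet {z : ℝ × ℝ | z.2 < z.1} := measurableSet_lt measurable_snd measurable_fst
  have hΦm : AEStronglyMeasurable Φ ((volume.restrict (Ioi (1 : ℝ))).prod (volume.restrict (Ioi (1 : ℝ)))) := by
    apply AEStronglyMeasurable.indicator _ hmS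
    apply AEStronglyMeasurable.mul
    · exact (hr.mono_measure Measure.restrict_le_self).comp_snd
    · exact (by fun_prop : Measurable fun z : ℝ × ℝ => (z.1 : ℂ) ^ (-(s + 1))).aestronglyMeasurable
  have hnorm : ∀ x t : ℝ, 1 < x → ‖Φ (x, t)‖ ≤ (Iio x).indicator (fun _ => x ^ (-(s.re + 1))) t := by
    intro x t hx
    simp only [hΦ]
    by_cases h : t < x
    · rw [indicator_of_mem (show (x, t) ∈ {z : ℝ × ℝ | z.2 < z.1} from h), indicator_of_mem (mem_Iio.mpr h), norm_mul,
        Complex.norm_cpow_eq_rpow_re_of_pos (by linarith)]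
      have := hb t
      simp only [neg_re, add_re, one_re]
      have h2 : 0 ≤ x ^ (-(s.re + 1)) := by positivity
      nlinarith
    · rw [indicator_of_notMem (show (x, t) ∉ {z : ℝ × ℝ | z.2 < z.1} from h), norm_zero]
      exact indicator_nonneg (fun _ _ => by positivity) _
  have hdom : ∀ x : ℝ, 1 < x → Integrable ((Iio x).indicator (fun _ : ℝ => x ^ (-(s.re + 1))))
      (volume.restrict (Ioi (1 : ℝ))) := by
    intro x hx
    rw [integrable_indicator_iff measurableSet_Iio, IntegrableOn, Measure.restrict_restrict measurableSet_Iio]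
    refine integrableOn_const ?_
    rw [inter_comm, Ioi_inter_Iio, Real.volume_Ioo]
    exact ENNReal.ofReal_ne_top
  have hIntg : Integrable Φ ((volume.restrict (Ioi (1 : ℝ))).prod (volume.restrict (Ioi (1 : ℝ)))) := by
    rw [integrable_prod_iff hΦm]
    constructor
    · filter_upwards [ae_restrict_mem measurableSet_Ioi, hΦm.prodMk_left] with x hx hmx
      exact (hdom x hx).mono' hmx (Eventually.of_forall fun t => hnorm x t hx)
    · refine Integrable.mono' (lin_integrable hs) hΦm.norm.integral_prod_right' ?_
      filter_upwards [ae_restrict_mem measurableSet_Ioi, hΦm.prodMk_left] with x hx hmx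
      have hx' : (1 : ℝ) < x := hx
      rw [Real.norm_of_nonneg (integral_nonneg fun _ => norm_nonneg _)]
      calc _ ≤ ∫ t in Ioi (1 : ℝ), (Iio x).indicator (fun _ : ℝ => x ^ (-(s.re + 1))) t := by
            apply integral_mono_of_nonneg (Eventually.of_forall fun _ => norm_nonneg _) (hdom x hx)
            exact Eventually.of_forall fun t => hnorm x t hx
        _ = (x - 1) * x ^ (-(s.re + 1)) := by
            rw [setIntegral_indicator measurableSet_Iio, Ioi_inter_Iio, setIntegral_const,
              Measure.real, Real.volume_Ioo, ENNReal.toReal_ofReal (by linarith), smul_eq_mul]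
        _ ≤ _ := by
            have h2 : 0 ≤ x ^ (-(s.re + 1)) := by positivity
            nlinarith
  have hswap := integral_integral_swap (f := fun x t => Φ (x, t)) hIntg
  have e1 : ∫ x in Ioi (1 : ℝ), (∫ t in (0 : ℝ)..x, r t) * (x : ℂ) ^ (-(s + 1)) =
      ∫ x in Ioi (1 : ℝ), ∫ t in Ioi (1 : ℝ), Φ (x, t) := by
    apply setIntegral_congr_fun measurableSet_Ioi
    intro x hx
    have hx' : (1 : ℝ) < x := hx
    simp only
    have : ∀ t, Φ (x, t) = (Iio x).indicator (fun t => r t * (x : ℂ) ^ (-(s + 1))) t := by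
      intro t; rfl
    simp only [this]
    rw [setIntegral_indicator measurableSet_Iio, integral_mul_const]
    congr 1
    rw [intervalIntegral.integral_of_le (by linarith), Ioi_inter_Iio, ← integral_Ioc_eq_integral_Ioo]
    apply setIntegral_eq_of_subset_of_forall_sdiff_eq_zero measurableSet_Ioc
    · exact Ioc_subset_Ioc_left zero_le_one
    · intro t ht
      apply hz
      by_contra hc
      push Not at hc
      exact ht.2 ⟨hc, ht.1.2⟩
  have e2 : ∀ t ∈ Ioi (1 : ℝ), ∫ x in Ioi (1 : ℝ), Φ (x, t) = s⁻¹ * (r t * (t : ℂ) ^ (-s)) := by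
    intro t ht
    have ht' : (1 : ℝ) < t := ht
    have : ∀ x, Φ (x, t) = (Ioi t).indicator (fun x : ℝ => r t * (x : ℂ) ^ (-(s + 1))) x := by
      intro x; rfl
    simp only [this]
    rw [setIntegral_indicator measurableSet_Ioi, integral_const_mul, inter_eq_right.mpr (Ioi_subset_Ioi ht'.le),
      integral_Ioi_cpow_of_lt (by simp; linarith) (by linarith)]
    rw [show -(s + 1) + 1 = -s by ring]
    field_simp
  rw [e1, hswap, setIntegral_congr_fun measurableSet_Ioi e2, integral_const_mul]
  field_simp

theorem prime_sum_eq (χ : ℕ → ℂ) (hχ : ∀ n : ℕ, 1 ≤ n → ‖χ n‖ = 1) {s : ℂ} (hs : 1 < s.re) :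
    ∑' p : Nat.Primes, χ (p : ℕ) * ((p : ℕ) : ℂ) ^ (-s) * (Real.log (p : ℕ) : ℂ) =
    s * ∫ t in Ioi (1 : ℝ), (∑ k ∈ Finset.Icc 1 ⌊t⌋₊, if k.Prime then χ k * (Real.log k : ℂ) else 0) *
      (t : ℂ) ^ (-(s + 1)) := by
  rw [← LSeries_eq_mul_integral' (fun k : ℕ => if k.Prime then χ k * (Real.log k : ℂ) else 0) zero_le_one hs]
  · rw [LSeries]
    have h := tsum_subtype {p : ℕ | p.Prime} (fun p : ℕ => χ p * (p : ℂ) ^ (-s) * (Real.log p : ℂ))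
    refine Eq.trans h ?_
    congr 1
    ext n
    by_cases hn : n.Prime
    · rw [indicator_of_mem (show n ∈ {p : ℕ | p.Prime} from hn), LSeries.term_of_ne_zero hn.ne_zero, if_pos hn, Complex.cpow_neg]
      ring
    · rw [indicator_of_notMem (show n ∉ {p : ℕ | p.Prime} from hn)]
      rcases eq_or_ne n 0 with rfl | h0
      · simp
      · rw [LSeries.term_of_ne_zero h0, if_neg hn, zero_div]
  · refine Asymptotics.IsBigO.of_bound (Real.log 4) (Eventually.of_forall fun n => ?_)
    have : ∑ k ∈ Finset.Icc 1 n, ‖(if k.Prime then χ k * (Real.log k : ℂ) else 0 : ℂ)‖ = Chebyshev.theta n := by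
      rw [Chebyshev.theta, Nat.floor_natCast, Finset.sum_filter]
      apply Finset.sum_congr rfl
      intro k hk
      split_ifs with h
      · rw [norm_mul, hχ k h.one_lt.le, one_mul, Complex.norm_real, Real.norm_of_nonneg (Real.log_natCast_nonneg _)]
      · simp
    rw [this, Real.norm_of_nonneg (Chebyshev.theta_nonneg _), Real.rpow_one, Real.norm_of_nonneg (by positivity)]
    exact Chebyshev.theta_le_log4_mul_x (by positivity)

theorem sum_bound (χ : ℕ → ℂ) (hχ : ∀ n : ℕ, 1 ≤ n → ‖χ n‖ = 1) (x : ℝ) :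
    ‖∑ k ∈ Finset.Icc 1 ⌊x⌋₊, (if k.Prime then χ k * (Real.log k : ℂ) else 0 : ℂ)‖ ≤ Chebyshev.theta x := by
  refine (norm_sum_le _ _).trans (le_of_eq ?_)
  rw [Chebyshev.theta, Finset.sum_filter]
  apply Finset.sum_congr rfl
  intro k hk
  split_ifs with h
  · rw [norm_mul, hχ k h.one_lt.le, one_mul, Complex.norm_real, Real.norm_of_nonneg (Real.log_natCast_nonneg _)]
  · simp

theorem integral_add_prime_sum_extends_RH (hRH : RiemannHypothesis) (q : ℝ → ℂ)
    (hq0 : Tendsto q atTop (𝓝 0))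
    (hqloc : LocallyIntegrableOn q (Ici 1)) :
    ∃ χ : ℕ → ℂ, χ 1 = 1 ∧ (∀ m n : ℕ, χ (m * n) = χ m * χ n) ∧
      (∀ n : ℕ, 1 ≤ n → ‖χ n‖ = 1) ∧
      ∃ G : ℂ → ℂ, AnalyticOnNhd ℂ G {s : ℂ | 1 / 2 < s.re} ∧
        ∀ s : ℂ, 1 < s.re →
          G s = (∫ x in Ioi (1 : ℝ), q x * (x : ℂ) ^ (-s)) +
            ∑' p : Nat.Primes, χ (p : ℕ) * ((p : ℕ) : ℂ) ^ (-s) * (Real.log (p : ℕ) : ℂ) := by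
  obtain ⟨X, hX1, hX⟩ : ∃ X : ℝ, 1 ≤ X ∧ ∀ x, X ≤ x → ‖q x‖ ≤ 1 := by
    have h1 : ∀ᶠ x in atTop, ‖q x‖ ≤ 1 := by
      have := hq0.norm.eventually (Iic_mem_nhds (by norm_num : ‖(0 : ℂ)‖ < 1))
      exact this
    obtain ⟨a, ha⟩ := eventually_atTop.mp h1
    exact ⟨max a 1, le_max_right _ _, fun x hx => ha x ((le_max_left _ _).trans hx)⟩
  have hqm : AEStronglyMeasurable q (volume.restrict (Ici 1)) := hqloc.aestronglyMeasurable
  set r : ℝ → ℂ := (Ioi X).indicator q with hr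
  have hrm : AEStronglyMeasurable r volume := by
    rw [hr, aestronglyMeasurable_indicator_iff measurableSet_Ioi]
    exact hqm.mono_set (fun x hx => hX1.trans (le_of_lt hx))
  have hrb : ∀ x, ‖r x‖ ≤ 1 := by
    intro x
    by_cases hx : x ∈ Ioi X
    · rw [hr, indicator_of_mem hx]; exact hX x (le_of_lt hx)
    · rw [hr, indicator_of_notMem hx]; simp
  have hrz : ∀ x, x ≤ 1 → r x = 0 := by
    intro x hx
    rw [hr, indicator_of_notMem]
    simp only [mem_Ioi, not_lt]; linarith
  have hri : ∀ a b : ℝ, IntervalIntegrable r volume a b := by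
    intro a b
    rw [intervalIntegrable_iff]
    refine Integrable.mono' (g := fun _ => (1 : ℝ)) (integrableOn_const ?_) (hrm.mono_measure Measure.restrict_le_self) (Eventually.of_forall hrb)
    rw [uIoc, Real.volume_Ioc]; exact ENNReal.ofReal_ne_top
  set Q : ℝ → ℂ := fun x => ∫ t in (0 : ℝ)..x, r t with hQdef
  have hQ : ∀ x y, ‖Q x - Q y‖ ≤ |x - y| := by
    intro x y
    simp only [hQdef]
    rw [intervalIntegral.integral_interval_sub_left (hri _ _) (hri _ _)]
    have := intervalIntegral.norm_integral_le_of_norm_le_const (a := y) (b := x) (f := r) (C := 1) (fun t _ => hrb t)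
    linarith
  have hQ0 : Q 0 = 0 := by simp [hQdef]
  have hQc : Continuous Q := by
    have : LipschitzWith 1 Q := by
      apply LipschitzWith.of_dist_le_mul
      intro x y
      rw [dist_eq_norm, Real.dist_eq]
      simpa using hQ x y
    exact this.continuous
  obtain ⟨χ, hχ1, hχm, hχn, hχb⟩ := chi_exists Q hQ hQ0
  refine ⟨χ, hχ1, hχm, hχn, ?_⟩
  set S : ℝ → ℂ := fun t => ∑ k ∈ Finset.Icc 1 ⌊t⌋₊, if k.Prime then χ k * (Real.log k : ℂ) else 0 with hS
  have hSm : Measurable S := by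
    have : Measurable (fun n : ℕ => ∑ k ∈ Finset.Icc 1 n, if k.Prime then χ k * (Real.log k : ℂ) else 0) :=
      measurable_from_nat
    exact this.comp Nat.measurable_floor
  have hE : ∀ x : ℝ, 1 ≤ x → ‖S x + Q x‖ ≤ |Chebyshev.theta x - x| + Real.log x := by
    intro x hx
    have h1 := hχb ⌊x⌋₊
    rw [← Chebyshev.theta_eq_theta_coe_floor] at h1
    have h2 := hQ (Chebyshev.theta x) x
    have h3 : Real.log (⌊x⌋₊ : ℝ) ≤ Real.log x := by
      apply Real.log_le_log
      · exact_mod_cast Nat.floor_pos.mpr hx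
      · exact Nat.floor_le (by linarith)
    calc ‖S x + Q x‖ = ‖(S x + Q (Chebyshev.theta x)) - (Q (Chebyshev.theta x) - Q x)‖ := by congr 1; ring
      _ ≤ ‖S x + Q (Chebyshev.theta x)‖ + ‖Q (Chebyshev.theta x) - Q x‖ := norm_sub_le _ _
      _ ≤ _ := by linarith
  set f2 : ℝ → ℂ := (Ioc 1 X).indicator (fun x => q x * (x : ℂ)) with hf2
  have hqI : IntegrableOn q (Ioc 1 X) :=
    (hqloc.integrableOn_compact_subset (Icc_subset_Ici_self : Icc 1 X ⊆ Ici 1) isCompact_Icc).mono_set Ioc_subset_Icc_self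
  have hf2m : AEStronglyMeasurable f2 volume := by
    rw [hf2, aestronglyMeasurable_indicator_iff measurableSet_Ioc]
    exact hqI.1.mul (by fun_prop : Measurable fun x : ℝ => (x : ℂ)).aestronglyMeasurable
  have hd1 : DifferentiableOn ℂ (fun s => ∫ x in Ioi (1 : ℝ), (S x + Q x) * (x : ℂ) ^ (-(s + 1))) {s : ℂ | 1 / 2 < s.re} := by
    refine mellin_diff _ (hSm.add hQc.measurable).aestronglyMeasurable ?_
    intro σ hσ
    refine Integrable.mono' (theta_L1 hRH hσ) ?_ ?_
    · exact ((hSm.add hQc.measurable).norm.mul (by fun_prop : Measurable fun x : ℝ => x ^ (-(σ + 1)))).aestronglyMeasurable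
    · filter_upwards [ae_restrict_mem measurableSet_Ioi] with x hx
      have hx : (1 : ℝ) < x := hx
      rw [Real.norm_of_nonneg (by positivity)]
      exact mul_le_mul_of_nonneg_right (hE x hx.le) (by positivity)
  have hd2 : DifferentiableOn ℂ (fun s => ∫ x in Ioi (1 : ℝ), f2 x * (x : ℂ) ^ (-(s + 1))) {s : ℂ | 1 / 2 < s.re} := by
    refine mellin_diff _ (hf2m.mono_measure Measure.restrict_le_self) ?_
    intro σ hσ
    have hg : Integrable ((Ioc 1 X).indicator (fun x => ‖q x‖)) :=
      (integrable_indicator_iff measurableSet_Ioc).mpr hqI.norm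
    refine Integrable.mono' (hg.mono_measure Measure.restrict_le_self) ?_ ?_
    · exact (hf2m.mono_measure Measure.restrict_le_self).norm.mul
        (by fun_prop : Measurable fun x : ℝ => x ^ (-(σ + 1))).aestronglyMeasurable
    · filter_upwards [ae_restrict_mem measurableSet_Ioi] with x hx
      have hx : (1 : ℝ) < x := hx
      rw [Real.norm_of_nonneg (by positivity)]
      by_cases hm : x ∈ Ioc 1 X
      · rw [hf2, indicator_of_mem hm, indicator_of_mem hm, norm_mul, Complex.norm_real,
          Real.norm_of_nonneg (by linarith), mul_assoc]
        have : x * x ^ (-(σ + 1)) ≤ 1 := by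
          have e : x * x ^ (-(σ + 1)) = x ^ (-σ) := by
            rw [show -σ = 1 + (-(σ + 1)) by ring, Real.rpow_add (by linarith), Real.rpow_one]
          rw [e]
          exact Real.rpow_le_one_of_one_le_of_nonpos hx.le (by linarith)
        calc _ ≤ ‖q x‖ * 1 := by gcongr
          _ = _ := mul_one _
      · rw [hf2, indicator_of_notMem hm, indicator_of_notMem hm]; simp
  refine ⟨fun s => s * (∫ x in Ioi (1 : ℝ), (S x + Q x) * (x : ℂ) ^ (-(s + 1))) +
    ∫ x in Ioi (1 : ℝ), f2 x * (x : ℂ) ^ (-(s + 1)), ?_, ?_⟩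
  · exact ((differentiableOn_id.mul hd1).add hd2).analyticOnNhd (isOpen_lt continuous_const continuous_re)
  · intro s hs
    simp only
    have hI1 : IntegrableOn (fun x : ℝ => S x * (x : ℂ) ^ (-(s + 1))) (Ioi 1) := by
      refine bdd_lin_integrable (C := Real.log 4) hSm ?_ hs
      intro x hx
      exact (sum_bound χ hχn x).trans (Chebyshev.theta_le_log4_mul_x (by linarith))
    have hI2 : IntegrableOn (fun x : ℝ => Q x * (x : ℂ) ^ (-(s + 1))) (Ioi 1) := by
      refine bdd_lin_integrable (C := 1) hQc.measurable ?_ hs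
      intro x hx
      have := hQ x 0
      rw [hQ0, sub_zero, sub_zero, abs_of_nonneg (by linarith)] at this
      linarith
    have e1 : ∫ x in Ioi (1 : ℝ), (S x + Q x) * (x : ℂ) ^ (-(s + 1)) =
        (∫ x in Ioi (1 : ℝ), S x * (x : ℂ) ^ (-(s + 1))) + ∫ x in Ioi (1 : ℝ), Q x * (x : ℂ) ^ (-(s + 1)) := by
      rw [← integral_add hI1 hI2]
      congr 1; ext x; ring
    have e2 := prime_sum_eq χ hχn hs
    have e3 := fubini_Q r hrm hrb hrz hs
    rw [e1, mul_add, e2, e3]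
    have hcp : ∀ x : ℝ, 1 < x → (x : ℂ) * (x : ℂ) ^ (-(s + 1)) = (x : ℂ) ^ (-s) := by
      intro x hx
      rw [show -s = 1 + (-(s + 1)) by ring, Complex.cpow_add _ _ (by exact_mod_cast (by linarith : x ≠ 0)), Complex.cpow_one]
    have hxs : ∀ x : ℝ, 1 < x → ‖(x : ℂ) ^ (-s)‖ ≤ 1 := by
      intro x hx
      rw [Complex.norm_cpow_eq_rpow_re_of_pos (by linarith)]
      exact Real.rpow_le_one_of_one_le_of_nonpos hx.le (by simp; linarith)
    have e4 : ∫ x in Ioi (1 : ℝ), f2 x * (x : ℂ) ^ (-(s + 1)) = ∫ x in Ioc 1 X, q x * (x : ℂ) ^ (-s) := by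
      have : ∀ x, f2 x * (x : ℂ) ^ (-(s + 1)) = (Ioc 1 X).indicator (fun x : ℝ => q x * (x : ℂ) ^ (-s)) x := by
        intro x
        by_cases hm : x ∈ Ioc 1 X
        · rw [hf2, indicator_of_mem hm, indicator_of_mem hm, mul_assoc, hcp x hm.1]
        · rw [hf2, indicator_of_notMem hm, indicator_of_notMem hm, zero_mul]
      simp only [this]
      rw [setIntegral_indicator measurableSet_Ioc, inter_eq_right.mpr Ioc_subset_Ioi_self]
    have e5 : ∫ t in Ioi (1 : ℝ), r t * (t : ℂ) ^ (-s) = ∫ x in Ioi X, q x * (x : ℂ) ^ (-s) := by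
      have : ∀ x : ℝ, r x * (x : ℂ) ^ (-s) = (Ioi X).indicator (fun x : ℝ => q x * (x : ℂ) ^ (-s)) x := by
        intro x
        by_cases hm : x ∈ Ioi X
        · rw [hr, indicator_of_mem hm, indicator_of_mem hm]
        · rw [hr, indicator_of_notMem hm, indicator_of_notMem hm, zero_mul]
      simp only [this]
      rw [setIntegral_indicator measurableSet_Ioi, inter_eq_right.mpr (Ioi_subset_Ioi hX1)]
    have hJ1 : IntegrableOn (fun x : ℝ => q x * (x : ℂ) ^ (-s)) (Ioc 1 X) := by
      refine Integrable.mono' hqI.norm ?_ ?_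
      · exact hqI.1.mul (by fun_prop : Measurable fun x : ℝ => (x : ℂ) ^ (-s)).aestronglyMeasurable
      · filter_upwards [ae_restrict_mem measurableSet_Ioc] with x hx
        rw [norm_mul]
        have := hxs x hx.1
        nlinarith [norm_nonneg (q x)]
    have hJ2 : IntegrableOn (fun x : ℝ => q x * (x : ℂ) ^ (-s)) (Ioi X) := by
      refine Integrable.mono' (integrableOn_Ioi_rpow_of_lt (a := -s.re) (by linarith) (by linarith : 0 < X)) ?_ ?_
      · exact (hqm.mono_set (fun x (hx : X < x) => hX1.trans hx.le)).mul
          (by fun_prop : Measurable fun x : ℝ => (x : ℂ) ^ (-s)).aestronglyMeasurable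
      · filter_upwards [ae_restrict_mem measurableSet_Ioi] with x hx
        have hx : X < x := hx
        rw [norm_mul, Complex.norm_cpow_eq_rpow_re_of_pos (by linarith), neg_re]
        have h1 := hX x hx.le
        have h2 : 0 ≤ x ^ (-s.re) := Real.rpow_nonneg (by linarith) _
        nlinarith
    have e6 : ∫ x in Ioi (1 : ℝ), q x * (x : ℂ) ^ (-s) =
        (∫ x in Ioc 1 X, q x * (x : ℂ) ^ (-s)) + ∫ x in Ioi X, q x * (x : ℂ) ^ (-s) := by
      rw [← Ioc_union_Ioi_eq_Ioi hX1, setIntegral_union (Ioc_disjoint_Ioi le_rfl) measurableSet_Ioi hJ1 hJ2]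
    rw [e4, e5, e6]
    ring
end

section
/- Let g be an analytic function in the half-plane Re z > 1 such that sup_{Re z > 1} |z|² |g(z)| < ∞. Then there exists a continuous function q : [1, ∞) → ℂ with q(x) → 0 as x → +∞ such that g(s) = ∫₁^∞ q(x) x^{-s} dx for all s with Re s > 1. -/
open Complex Filter Topology Set MeasureTheory

open scoped FourierTransform

/-- Plancherel for a continuous integrable function with integrable inverse transform. -/
lemma aux_plancherel {G : ℝ → ℂ} (hc : Continuous G) (hG : Integrable G)
    (hP : Integrable (𝓕⁻ G)) : ∫ t, ‖𝓕⁻ G t‖ ^ 2 = ∫ v, ‖G v‖ ^ 2 := by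
  have hF : Integrable (𝓕 G) := by
    have h := hP.comp_neg
    refine h.congr (Eventually.of_forall fun t => ?_)
    simp [Real.fourierInv_eq_fourier_neg]
  have hinv : 𝓕 (𝓕⁻ G) = G := hc.fourier_fourierInv_eq hG hF
  have h := VectorFourier.integral_sesq_fourierIntegral_eq_neg_flip (innerSL ℂ)
    (L := innerₗ ℝ) Real.continuous_fourierChar continuous_inner hP hG
  have h2 : ∫ ξ, inner ℂ (𝓕 (𝓕⁻ G) ξ) (G ξ) = ∫ x, inner ℂ (𝓕⁻ G x) (𝓕⁻ G x) := by
    rw [flip_innerₗ] at h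
    exact h
  rw [hinv] at h2
  apply Complex.ofRealLI.injective
  simpa [← LinearIsometry.integral_comp_comm, inner_self_eq_norm_sq_to_K] using h2.symm

lemma aux_barbalat {Q : ℝ → ℂ} (hQ : UniformContinuous Q) {M : ℝ}
    (hM : ∀ T, 0 ≤ T → ∫ t in (0:ℝ)..T, ‖Q t‖ ^ 2 ≤ M) : Tendsto Q atTop (𝓝 0) := by
  have hcont : Continuous fun t => ‖Q t‖ ^ 2 := (hQ.continuous.norm).pow 2
  have hii : ∀ a b : ℝ, IntervalIntegrable (fun t => ‖Q t‖ ^ 2) volume a b :=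
    fun a b => hcont.intervalIntegrable a b
  set F : ℝ → ℝ := fun T => ∫ t in (0:ℝ)..T, ‖Q t‖ ^ 2 with hF
  have hsub : ∀ a b, F b - F a = ∫ t in a..b, ‖Q t‖ ^ 2 := fun a b =>
    intervalIntegral.integral_interval_sub_left (hii _ _) (hii _ _)
  have hmono : Monotone F := by
    intro a b hab
    have : 0 ≤ F b - F a := by
      rw [hsub]; exact intervalIntegral.integral_nonneg hab fun _ _ => by positivity
    linarith
  have hbd : BddAbove (range F) := by
    refine ⟨M, ?_⟩
    rintro _ ⟨T, rfl⟩
    exact (hmono (le_max_left T 0)).trans (hM _ (le_max_right _ _))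
  have hlim := tendsto_atTop_ciSup hmono hbd
  rw [Metric.tendsto_atTop]
  intro ε hε
  obtain ⟨δ, hδ, hd⟩ := Metric.uniformContinuous_iff.1 hQ (ε / 2) (by positivity)
  have hdiff : Tendsto (fun t => F (t + δ / 2) - F t) atTop (𝓝 0) := by
    simpa using (hlim.comp (tendsto_atTop_add_const_right _ (δ / 2) tendsto_id)).sub hlim
  obtain ⟨N, hN⟩ := (eventually_atTop.1 (hdiff.eventually_lt_const
    (show (0:ℝ) < (ε / 2) ^ 2 * (δ / 2) by positivity)))
  refine ⟨N, fun t ht => ?_⟩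
  by_contra! hcon
  have h1 := hN t ht
  rw [hsub] at h1
  have h2 : ∫ _ in t..(t + δ / 2), (ε / 2) ^ 2 ≤ ∫ u in t..(t + δ / 2), ‖Q u‖ ^ 2 := by
    apply intervalIntegral.integral_mono_on (by linarith) (by simp) (hii _ _)
    intro u hu
    have h3 := hd (a := u) (b := t) (by rw [Real.dist_eq, abs_of_nonneg] <;> linarith [hu.1, hu.2])
    rw [dist_eq_norm] at h3
    rw [dist_zero_right] at hcon
    have h4 : ‖Q t‖ ≤ ‖Q u‖ + ‖Q u - Q t‖ := by
      have := norm_sub_le (Q u) (Q u - Q t)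
      simpa using this
    gcongr
    linarith
  simp at h2
  linarith

lemma aux_contour {φ : ℂ → ℂ} {c₁ c₂ K : ℝ} (h : c₁ ≤ c₂)
    (hd : ∀ z : ℂ, c₁ ≤ z.re → DifferentiableAt ℂ φ z)
    (hb : ∀ x y : ℝ, c₁ ≤ x → x ≤ c₂ → ‖φ (x + y * I)‖ ≤ K * (1 + y ^ 2)⁻¹) :
    ∫ y : ℝ, φ (c₁ + y * I) = ∫ y : ℝ, φ (c₂ + y * I) := by
  have hcont : ∀ c : ℝ, c₁ ≤ c → Continuous fun y : ℝ => φ (c + y * I) := by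
    intro c hc
    rw [continuous_iff_continuousAt]
    intro y
    have := (hd (c + y * I) (by simpa using hc)).continuousAt
    exact ContinuousAt.comp (f := fun y : ℝ => (c : ℂ) + y * I) this (by fun_prop)
  have hint : ∀ c : ℝ, c₁ ≤ c → c ≤ c₂ → Integrable fun y : ℝ => φ (c + y * I) := by
    intro c hc hc'
    refine (integrable_inv_one_add_sq.const_mul K).mono' (hcont c hc).aestronglyMeasurable ?_
    exact Eventually.of_forall fun y => hb c y hc hc'
  have hlim : ∀ c : ℝ, c₁ ≤ c → c ≤ c₂ → Tendsto (fun R : ℝ => ∫ y in (-R)..R, φ (c + y * I)) atTop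
      (𝓝 (∫ y : ℝ, φ (c + y * I))) := fun c hc hc' =>
    intervalIntegral_tendsto_integral (hint c hc hc') tendsto_neg_atTop_atBot tendsto_id
  have hdec : Tendsto (fun R : ℝ => K * (1 + R ^ 2)⁻¹ * |c₂ - c₁|) atTop (𝓝 0) := by
    have : Tendsto (fun R : ℝ => (1 + R ^ 2)⁻¹) atTop (𝓝 0) :=
      tendsto_inv_atTop_zero.comp (tendsto_atTop_add_const_left _ _ (tendsto_pow_atTop two_ne_zero))
    simpa using (this.const_mul K).mul_const |c₂ - c₁|
  have hedge : ∀ R : ℝ, ‖∫ x : ℝ in c₁..c₂, φ (x + R * I)‖ ≤ K * (1 + R ^ 2)⁻¹ * |c₂ - c₁| := by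
    intro R
    apply intervalIntegral.norm_integral_le_of_norm_le_const
    intro x hx
    rw [uIoc_of_le h] at hx
    exact hb x R hx.1.le hx.2
  have htop : Tendsto (fun R : ℝ => ∫ x : ℝ in c₁..c₂, φ (x + R * I)) atTop (𝓝 0) :=
    squeeze_zero_norm hedge hdec
  have hbot : Tendsto (fun R : ℝ => ∫ x : ℝ in c₁..c₂, φ (x + (-R : ℝ) * I)) atTop (𝓝 0) := by
    refine squeeze_zero_norm (fun R => ?_) hdec
    simpa using hedge (-R)
  have hrect : ∀ R : ℝ, (∫ x : ℝ in c₁..c₂, φ (x + (-R : ℝ) * I)) -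
      (∫ x : ℝ in c₁..c₂, φ (x + R * I)) + I • (∫ y : ℝ in (-R)..R, φ (c₂ + y * I)) -
      I • (∫ y : ℝ in (-R)..R, φ (c₁ + y * I)) = 0 := by
    intro R
    have := integral_boundary_rect_eq_zero_of_differentiableOn φ ⟨c₁, -R⟩ ⟨c₂, R⟩ (by
      intro z hz
      refine (hd z ?_).differentiableWithinAt
      have := hz.1
      simp [uIcc_of_le h] at this
      exact this.1)
    simpa using this
  have hL := ((hbot.sub htop).add ((hlim c₂ h le_rfl).const_smul I)).sub
    ((hlim c₁ le_rfl h).const_smul I)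
  have h0 := tendsto_nhds_unique (hL.congr hrect) tendsto_const_nhds
  simp only [sub_self, zero_add, smul_eq_mul, ← mul_sub] at h0
  have := (mul_eq_zero.1 h0).resolve_left I_ne_zero
  exact (sub_eq_zero.1 this).symm

lemma aux_core {G : ℝ → ℝ → ℂ} {Q : ℝ → ℂ} {C : ℝ} (hC : 0 ≤ C)
    (hGc : ∀ a, 0 < a → Continuous (G a))
    (hGb : ∀ a, 0 < a → ∀ v, ‖G a v‖ ≤ C * (1 + v ^ 2)⁻¹)
    (hQ : ∀ a, 0 < a → ∀ t, Q t = Real.exp (a * t) * 𝓕⁻ (G a) t) :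
    Continuous Q ∧ Tendsto Q atTop (𝓝 0) ∧
      ∀ a, 0 < a → ∀ v, G a v = ∫ t in Ioi (0:ℝ), Q t * cexp (-(a + 2 * Real.pi * v * I) * t) := by
  have hBi : Integrable fun v : ℝ => C * (1 + v ^ 2)⁻¹ := integrable_inv_one_add_sq.const_mul C
  have hGi : ∀ a, 0 < a → Integrable (G a) := fun a ha =>
    hBi.mono' (hGc a ha).aestronglyMeasurable (Eventually.of_forall (hGb a ha))
  set M : ℝ := ∫ v : ℝ, C * (1 + v ^ 2)⁻¹ with hMdef
  have hP : ∀ a, 0 < a → ∀ t, 𝓕⁻ (G a) t = Real.exp (-(a * t)) * Q t := by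
    intro a ha t
    rw [hQ a ha t, ← mul_assoc, ← ofReal_mul, ← Real.exp_add]
    simp
  have hPb : ∀ a, 0 < a → ∀ t, ‖𝓕⁻ (G a) t‖ ≤ M := by
    intro a ha t
    rw [Real.fourierInv_eq]
    refine norm_integral_le_of_norm_le hBi (Eventually.of_forall fun v => ?_)
    simpa using hGb a ha v
  have hQb' : ∀ a, 0 < a → ∀ t, ‖Q t‖ ≤ Real.exp (a * t) * M := by
    intro a ha t
    rw [hQ a ha t, norm_mul, norm_real, Real.norm_eq_abs, Real.abs_exp]
    gcongr
    exact hPb a ha t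
  have hlim0 : ∀ t : ℝ, Tendsto (fun a : ℝ => Real.exp (a * t)) (𝓝[>] 0) (𝓝 1) := by
    intro t
    have : Continuous fun a : ℝ => Real.exp (a * t) := by fun_prop
    simpa using (this.tendsto 0).mono_left nhdsWithin_le_nhds
  have hQb : ∀ t, ‖Q t‖ ≤ M := by
    intro t
    have h := (hlim0 t).mul_const M
    rw [one_mul] at h
    refine ge_of_tendsto h ?_
    filter_upwards [self_mem_nhdsWithin] with a ha using hQb' a ha t
  have hQ0 : ∀ t < 0, Q t = 0 := by
    intro t ht
    have h : Tendsto (fun a : ℝ => Real.exp (a * t) * M) atTop (𝓝 0) := by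
      have := (Real.tendsto_exp_atBot.comp
        (tendsto_id.atTop_mul_const_of_neg ht)).mul_const M
      simpa using this
    have : ‖Q t‖ ≤ 0 := by
      refine ge_of_tendsto h ?_
      filter_upwards [eventually_gt_atTop 0] with a ha using hQb' a ha t
    simpa using this
  -- the modulus of continuity
  set ω : ℝ → ℝ := fun u => ∫ v : ℝ, ‖(𝐞 (v * u) : ℂ) - 1‖ * (C * (1 + v ^ 2)⁻¹) with hω
  have hchar : Continuous fun x : ℝ => (𝐞 x : ℂ) :=
    continuous_subtype_val.comp Real.continuous_fourierChar
  have hωb : ∀ u v : ℝ, ‖‖(𝐞 (v * u) : ℂ) - 1‖ * (C * (1 + v ^ 2)⁻¹)‖ ≤ 2 * (C * (1 + v ^ 2)⁻¹) := by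
    intro u v
    have h1 : ‖(𝐞 (v * u) : ℂ) - 1‖ ≤ 2 := by
      refine (norm_sub_le _ _).trans ?_
      rw [Circle.norm_coe, norm_one]; norm_num
    rw [norm_mul, norm_norm, Real.norm_of_nonneg (by positivity)]
    gcongr
  have hBc : Continuous fun v : ℝ => C * (1 + v ^ 2)⁻¹ := by
    refine continuous_const.mul (Continuous.inv₀ (by fun_prop) fun v => by positivity)
  have hωm : ∀ u, Continuous fun v : ℝ => ‖(𝐞 (v * u) : ℂ) - 1‖ * (C * (1 + v ^ 2)⁻¹) := by
    intro u
    exact (((hchar.comp (by fun_prop : Continuous fun v : ℝ => v * u)).sub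
      continuous_const).norm).mul hBc
  have hωc : Continuous ω := by
    refine continuous_of_dominated (bound := fun v => 2 * (C * (1 + v ^ 2)⁻¹))
      (fun u => (hωm u).aestronglyMeasurable)
      (fun u => Eventually.of_forall (hωb u)) (hBi.const_mul 2) (Eventually.of_forall fun v => ?_)
    exact (((hchar.comp (by fun_prop : Continuous fun u : ℝ => v * u)).sub
      continuous_const).norm).mul continuous_const
  have hω0 : ω 0 = 0 := by simp [hω]
  have hPd : ∀ a, 0 < a → ∀ t u, ‖𝓕⁻ (G a) t - 𝓕⁻ (G a) u‖ ≤ ω (t - u) := by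
    intro a ha t u
    rw [Real.fourierInv_eq, Real.fourierInv_eq]
    have hi : ∀ t : ℝ, Integrable fun v : ℝ => 𝐞 (inner ℝ v t) • G a v := by
      intro t
      have hcc : Continuous fun v : ℝ => 𝐞 (inner ℝ v t) • G a v :=
        (Real.continuous_fourierChar.comp (by fun_prop)).smul (hGc a ha)
      refine hBi.mono' hcc.aestronglyMeasurable (Eventually.of_forall fun v => ?_)
      simpa using hGb a ha v
    rw [← integral_sub (hi t) (hi u)]
    refine norm_integral_le_of_norm_le ((hBi.const_mul 2).mono' (hωm (t - u)).aestronglyMeasurable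
      (Eventually.of_forall (hωb (t - u)))) (Eventually.of_forall fun v => ?_)
    have e : 𝐞 (inner ℝ v t) • G a v - 𝐞 (inner ℝ v u) • G a v =
        (𝐞 (v * u) : ℂ) * (((𝐞 (v * (t - u)) : ℂ) - 1) * G a v) := by
      have : (𝐞 (v * t) : ℂ) = 𝐞 (v * u) * 𝐞 (v * (t - u)) := by
        rw [← Circle.coe_mul, ← AddChar.map_add_eq_mul]; ring_nf
      simp only [Circle.smul_def, smul_eq_mul]
      have e1 : inner ℝ v t = v * t := by simp [mul_comm]
      have e2 : inner ℝ v u = v * u := by simp [mul_comm]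
      rw [e1, e2, this]; ring
    rw [e, norm_mul, norm_mul, Circle.norm_coe, one_mul]
    gcongr
    exact hGb a ha v
  have hQd : ∀ t u, ‖Q t - Q u‖ ≤ ω (t - u) := by
    intro t u
    have h1 : ∀ t : ℝ, Tendsto (fun a : ℝ => (Real.exp (-(a * t)) : ℂ) * Q t) (𝓝[>] 0)
        (𝓝 (Q t)) := by
      intro t
      have h := ((Complex.continuous_ofReal.tendsto 1).comp (hlim0 (-t))).mul_const (Q t)
      simpa [Function.comp_def] using h
    refine le_of_tendsto ((h1 t).sub (h1 u)).norm ?_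
    filter_upwards [self_mem_nhdsWithin] with a ha
    rw [← hP a ha, ← hP a ha]
    exact hPd a ha t u
  have hQu : UniformContinuous Q := by
    rw [Metric.uniformContinuous_iff]
    intro ε hε
    obtain ⟨δ, hδ, hd⟩ := Metric.continuousAt_iff.1 (hωc.continuousAt (x := 0)) ε hε
    refine ⟨δ, hδ, fun {t u} htu => ?_⟩
    have h := hd (x := t - u) (by simpa [Real.dist_eq] using htu)
    rw [hω0, Real.dist_eq, sub_zero] at h
    rw [dist_eq_norm]
    exact (hQd t u).trans_lt ((le_abs_self _).trans_lt h)
  have hPi : ∀ a, 0 < a → Integrable (𝓕⁻ (G a)) := by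
    intro a ha
    have h1 : IntegrableOn (𝓕⁻ (G a)) (Ici 0) := by
      rw [integrableOn_Ici_iff_integrableOn_Ioi]
      have h2 : IntegrableOn (fun t : ℝ => Real.exp (-a * t) * M) (Ioi 0) :=
        (integrableOn_exp_mul_Ioi (by linarith) 0).mul_const M
      have hcP : Continuous (𝓕⁻ (G a)) := by
        rw [show 𝓕⁻ (G a) = _ from funext (hP a ha)]
        exact (Continuous.mul (by fun_prop) hQu.continuous)
      refine Integrable.mono' h2 hcP.aestronglyMeasurable (Eventually.of_forall fun t => ?_)
      rw [hP a ha t, norm_mul, norm_real, Real.norm_eq_abs, Real.abs_exp, neg_mul]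
      gcongr
      exact hQb t
    have h3 := (integrableOn_iff_integrable_of_support_subset (μ := volume) (f := 𝓕⁻ (G a))
      (s := Ici 0) ?_).1 h1
    · exact h3
    · intro t ht
      by_contra hcon
      simp only [mem_Ici, not_le] at hcon
      exact ht (by rw [hP a ha t, hQ0 t hcon, mul_zero])
  refine ⟨hQu.continuous, ?_, ?_⟩
  · set S : ℝ := ∫ v : ℝ, C ^ 2 * (1 + v ^ 2)⁻¹
    refine aux_barbalat hQu (M := S) fun T hT => ?_
    have hkey : ∀ a, 0 < a → ∫ t in (0:ℝ)..T, ‖Q t‖ ^ 2 ≤ Real.exp (a * T) ^ 2 * S := by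
      intro a ha
      have hpl := aux_plancherel (hGc a ha) (hGi a ha) (hPi a ha)
      have hsq : Integrable fun t => ‖𝓕⁻ (G a) t‖ ^ 2 := by
        refine ((hPi a ha).norm.const_mul M).mono'
          ((hPi a ha).aestronglyMeasurable.norm.pow 2) (Eventually.of_forall fun t => ?_)
        rw [Real.norm_of_nonneg (by positivity), sq]
        gcongr
        exact hPb a ha t
      have hS : ∫ v, ‖G a v‖ ^ 2 ≤ S := by
        refine integral_mono_of_nonneg (Eventually.of_forall fun v => by positivity)
          (integrable_inv_one_add_sq.const_mul _) (Eventually.of_forall fun v => ?_)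
        have h1 : ‖G a v‖ ^ 2 ≤ (C * (1 + v ^ 2)⁻¹) ^ 2 := by
          gcongr
          exact hGb a ha v
        refine h1.trans ?_
        have h2 : (1 + v ^ 2)⁻¹ ≤ 1 := inv_le_one_of_one_le₀ (by nlinarith [sq_nonneg v])
        have h3 : 0 ≤ (1 + v ^ 2)⁻¹ := by positivity
        rw [mul_pow]
        refine mul_le_mul_of_nonneg_left ?_ (sq_nonneg C)
        nlinarith
      calc ∫ t in (0:ℝ)..T, ‖Q t‖ ^ 2
          ≤ ∫ t in (0:ℝ)..T, Real.exp (a * T) ^ 2 * ‖𝓕⁻ (G a) t‖ ^ 2 := by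
            refine intervalIntegral.integral_mono_on hT
              ((hQu.continuous.norm.pow 2).intervalIntegrable _ _)
              ((hsq.const_mul _).intervalIntegrable) fun t ht => ?_
            rw [hQ a ha t, norm_mul, norm_real, Real.norm_eq_abs, Real.abs_exp, mul_pow]
            gcongr
            exact ht.2
        _ = Real.exp (a * T) ^ 2 * ∫ t in (0:ℝ)..T, ‖𝓕⁻ (G a) t‖ ^ 2 := by
            rw [intervalIntegral.integral_const_mul]
        _ ≤ Real.exp (a * T) ^ 2 * S := by
            gcongr
            refine le_trans ?_ (hpl.le.trans hS)
            rw [intervalIntegral.integral_of_le hT]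
            exact setIntegral_le_integral hsq (Eventually.of_forall fun t => by positivity)
    have h := ((hlim0 T).pow 2).mul_const S
    rw [one_pow, one_mul] at h
    refine ge_of_tendsto h ?_
    filter_upwards [self_mem_nhdsWithin] with a ha using hkey a ha
  · intro a ha v
    have hF : Integrable (𝓕 (G a)) := by
      refine (hPi a ha).comp_neg.congr (Eventually.of_forall fun t => ?_)
      simp [Real.fourierInv_eq_fourier_neg]
    have hinv : 𝓕 (𝓕⁻ (G a)) = G a := (hGc a ha).fourier_fourierInv_eq (hGi a ha) hF
    conv_lhs => rw [← hinv, Real.fourier_eq']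
    rw [← integral_Ici_eq_integral_Ioi, ← setIntegral_eq_integral_of_forall_compl_eq_zero (s := Ici 0)]
    · refine integral_congr_ae (Eventually.of_forall fun t => ?_)
      simp only [hP a ha t, smul_eq_mul]
      have : cexp (-(a + 2 * Real.pi * v * I) * t) =
          cexp (((-2 * Real.pi * inner ℝ t v : ℝ) : ℂ) * I) * (Real.exp (-(a * t)) : ℝ) := by
        rw [ofReal_exp, ← Complex.exp_add]
        congr 1
        simp
        ring
      rw [this]; ring
    · intro t ht
      simp only [mem_Ici, not_le] at ht
      rw [hP a ha t, hQ0 t ht, mul_zero, smul_zero]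

theorem analytic_eq_mellin_of_decay (g : ℂ → ℂ)
    (hg : AnalyticOnNhd ℂ g {z : ℂ | 1 < z.re})
    (hbd : ∃ C : ℝ, ∀ z : ℂ, 1 < z.re → ‖z‖ ^ 2 * ‖g z‖ ≤ C) :
    ∃ q : ℝ → ℂ, ContinuousOn q (Ici 1) ∧ Tendsto q atTop (𝓝 0) ∧
      ∀ s : ℂ, 1 < s.re → g s = ∫ x in Ioi (1 : ℝ), q x * (x : ℂ) ^ (-s) := by
  obtain ⟨C, hC⟩ := hbd
  have hC0 : 0 ≤ C := le_trans (by positivity) (hC 2 (by norm_num))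
  have hb : ∀ x y : ℝ, 1 < x → ‖g (x + y * I)‖ ≤ C * (1 + y ^ 2)⁻¹ := by
    intro x y hx
    have h := hC (x + y * I) (by simpa using hx)
    have hn : ‖(x + y * I : ℂ)‖ ^ 2 = x ^ 2 + y ^ 2 := by
      rw [Complex.sq_norm, Complex.normSq_add_mul_I]
    rw [hn] at h
    rw [← div_eq_mul_inv, le_div_iff₀ (by positivity), mul_comm]
    refine le_trans ?_ h
    gcongr
    nlinarith
  set G : ℝ → ℝ → ℂ := fun a v => g (((1 + a : ℝ) : ℂ) + ((2 * Real.pi * v : ℝ) : ℂ) * I) with hG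
  set Q : ℝ → ℂ := fun t => Real.exp (1 * t) * 𝓕⁻ (G 1) t with hQdef
  have hdiff : ∀ z : ℂ, 1 < z.re → DifferentiableAt ℂ g z := fun z hz => (hg z hz).differentiableAt
  have hGc : ∀ a, 0 < a → Continuous (G a) := by
    intro a ha
    rw [continuous_iff_continuousAt]
    intro v
    exact ContinuousAt.comp
      (f := fun v : ℝ => ((1 + a : ℝ) : ℂ) + ((2 * Real.pi * v : ℝ) : ℂ) * I)
      (hdiff _ (by simpa using ha)).continuousAt (by fun_prop)
  have hGb : ∀ a, 0 < a → ∀ v, ‖G a v‖ ≤ C * (1 + v ^ 2)⁻¹ := by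
    intro a ha v
    refine (hb (1 + a) (2 * Real.pi * v) (by linarith)).trans ?_
    refine mul_le_mul_of_nonneg_left (inv_anti₀ (by positivity) ?_) hC0
    rw [mul_pow]
    have : (1:ℝ) ≤ (2 * Real.pi) ^ 2 := by nlinarith [Real.pi_gt_three]
    nlinarith [sq_nonneg v]
  -- relation with the contour integral
  have hT : ∀ a t : ℝ, Real.exp (a * t) * 𝓕⁻ (G a) t = ((2 * Real.pi)⁻¹ : ℝ) •
      ∫ y : ℝ, cexp ((((1 + a : ℝ) + y * I) - 1) * t) * g ((1 + a : ℝ) + y * I) := by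
    intro a t
    have h := Measure.integral_comp_mul_left
      (fun y : ℝ => cexp ((((1 + a : ℝ) + y * I) - 1) * t) * g ((1 + a : ℝ) + y * I)) (2 * Real.pi)
    rw [abs_of_pos (by positivity)] at h
    rw [← h, Real.fourierInv_eq', ← integral_const_mul]
    refine integral_congr_ae (Eventually.of_forall fun v => ?_)
    simp only [hG, smul_eq_mul]
    rw [ofReal_exp, ← mul_assoc, ← Complex.exp_add]
    congr 2
    simp
    ring
  have hmono : ∀ a b t : ℝ, 0 < a → a ≤ b →
      (Real.exp (a * t) : ℂ) * 𝓕⁻ (G a) t = Real.exp (b * t) * 𝓕⁻ (G b) t := by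
    intro a b t ha hab
    rw [hT, hT]
    congr 1
    refine aux_contour (φ := fun z => cexp ((z - 1) * t) * g z) (K := Real.exp (b * |t|) * C)
      (by linarith) ?_ ?_
    · intro z hz
      exact DifferentiableAt.mul (by fun_prop) (hdiff z (by linarith))
    · intro x y hx hx'
      rw [norm_mul, mul_assoc]
      gcongr
      · rw [Complex.norm_exp]
        gcongr
        have : (((x : ℂ) + y * I - 1) * t).re = (x - 1) * t := by simp
        rw [this]
        calc (x - 1) * t ≤ (x - 1) * |t| := by gcongr; linarith; exact le_abs_self t
          _ ≤ b * |t| := by gcongr; linarith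
      · exact hb x y (by linarith)
  have hQ : ∀ a, 0 < a → ∀ t, Q t = Real.exp (a * t) * 𝓕⁻ (G a) t := by
    intro a ha t
    rcases le_total a 1 with h | h
    · exact (hmono a 1 t ha h).symm
    · exact hmono 1 a t one_pos h
  obtain ⟨hQc, hQ0, hrep⟩ := aux_core hC0 hGc hGb hQ
  refine ⟨fun x => Q (Real.log x), ?_, hQ0.comp Real.tendsto_log_atTop, ?_⟩
  · refine hQc.comp_continuousOn (Real.continuousOn_log.mono fun x hx => ?_)
    have : (1:ℝ) ≤ x := hx
    simp
    linarith
  · intro s hs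
    have h := hrep (s.re - 1) (by linarith) (s.im / (2 * Real.pi))
    have e1 : G (s.re - 1) (s.im / (2 * Real.pi)) = g s := by
      simp only [hG]
      congr 1
      rw [mul_div_cancel₀ _ (by positivity)]
      apply Complex.ext <;> simp
    rw [← e1, h]
    have himg : Real.exp '' Ioi 0 = Ioi 1 := by
      ext x
      constructor
      · rintro ⟨t, ht, rfl⟩
        exact Real.one_lt_exp_iff.2 ht
      · intro hx
        have hx' : (1:ℝ) < x := hx
        exact ⟨Real.log x, Real.log_pos hx', Real.exp_log (by linarith)⟩
    rw [← himg, integral_image_eq_integral_abs_deriv_smul measurableSet_Ioi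
      (fun t _ => (Real.hasDerivAt_exp t).hasDerivWithinAt) Real.exp_injective.injOn]
    refine integral_congr_ae (Eventually.of_forall fun t => ?_)
    simp only [Real.log_exp, Real.abs_exp, real_smul]
    have hp : ((Real.exp t : ℝ) : ℂ) ^ (-s) = cexp (-s * t) := by
      rw [cpow_def_of_ne_zero (by exact_mod_cast (Real.exp_pos t).ne'), ← ofReal_log (Real.exp_pos t).le,
        Real.log_exp, mul_comm]
    rw [hp, ofReal_exp, mul_left_comm, ← Complex.exp_add]
    congr 2
    have hpi : (Real.pi : ℂ) ≠ 0 := by exact_mod_cast Real.pi_ne_zero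
    conv_rhs => rw [← Complex.re_add_im s]
    push_cast
    field_simp
    ring
end
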